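/- arXiv:1808.01498 — 3 statements merged into one kernel-verified Lean document; each statement's English description precedes it below -/
import Mathlib

section
/- Amortization collapse of the sandwiched Rényi divergences for classical-quantum channels: let N, M : X → B be classical-quantum channels determined by finite families of states {ν_B^x}_{x∈X} and {μ_B^x}_{x∈X}. Then for all α ≥ 1/2, the amortized sandwiched Rényi channel divergence satisfies D̃_α^A(N‖M) = max_{x∈X} D̃_α(ν_B^x ‖ μ_B^x). -/
open scoped BigOperators ComplexOrder

noncomputable section

attribute [local instance] Classical.propDecidable

/-- A density matrix (quantum state): positive semidefinite with unit trace. -/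
def IsDensity {ι : Type} [Fintype ι] (ρ : Matrix ι ι ℂ) : Prop :=
  ρ.PosSemidef ∧ ρ.trace = 1

/-- The map `id_R ⊗ Φ` (for linear `Φ`), defined blockwise. -/
def idTensor {R ι κ : Type} (Φ : Matrix ι ι ℂ → Matrix κ κ ℂ)
    (X : Matrix (R × ι) (R × ι) ℂ) : Matrix (R × κ) (R × κ) ℂ :=
  fun p q => Φ (fun a b => X (p.1, a) (q.1, b)) p.2 q.2

/-- The map `Φ ⊗ id_E` (for linear `Φ`), defined blockwise. -/
def tensorId {ι κ E : Type} (Φ : Matrix ι ι ℂ → Matrix κ κ ℂ)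
    (X : Matrix (ι × E) (ι × E) ℂ) : Matrix (κ × E) (κ × E) ℂ :=
  fun p q => Φ (fun a b => X (a, p.2) (b, q.2)) p.1 q.1

/-- A quantum channel: linear, trace preserving, and completely positive. -/
structure IsChannel {ι κ : Type} [Fintype ι] [Fintype κ]
    (Φ : Matrix ι ι ℂ → Matrix κ κ ℂ) : Prop where
  linear : IsLinearMap ℂ Φ
  tracePres : ∀ X, (Φ X).trace = X.trace
  compPos : ∀ (k : ℕ) (X : Matrix (Fin k × ι) (Fin k × ι) ℂ),
      X.PosSemidef → (idTensor Φ X).PosSemidef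

/-- A family of divergences, one for every finite dimension. -/
abbrev DivFam : Type 1 :=
  ∀ (ι : Type) [Fintype ι] [DecidableEq ι], Matrix ι ι ℂ → Matrix ι ι ℂ → EReal

/-- Data processing: a generalized divergence does not increase under channels. -/
def DivDataProcessing (D : DivFam) : Prop :=
  ∀ (ι κ : Type) [Fintype ι] [DecidableEq ι] [Fintype κ] [DecidableEq κ]
    (Φ : Matrix ι ι ℂ → Matrix κ κ ℂ), IsChannel Φ →
    ∀ ρ σ : Matrix ι ι ℂ, IsDensity ρ → IsDensity σ →
      D κ (Φ ρ) (Φ σ) ≤ D ι ρ σ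

/-- Faithfulness: `D(ρ‖ρ) ≤ 0` for every state `ρ`. -/
def DivFaithful (D : DivFam) : Prop :=
  ∀ (ι : Type) [Fintype ι] [DecidableEq ι] (ρ : Matrix ι ι ℂ),
    IsDensity ρ → D ι ρ ρ ≤ 0

/-- Strong faithfulness: `D(ρ‖σ) = 0` iff `ρ = σ`. -/
def DivStronglyFaithful (D : DivFam) : Prop :=
  ∀ (ι : Type) [Fintype ι] [DecidableEq ι] (ρ σ : Matrix ι ι ℂ),
    IsDensity ρ → IsDensity σ → (D ι ρ σ = 0 ↔ ρ = σ)

/-- The generalized channel divergence `D(N‖M)`. -/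
def channelDiv (D : DivFam) {ι κ : Type} [Fintype ι] [DecidableEq ι] [Fintype κ] [DecidableEq κ]
    (N M : Matrix ι ι ℂ → Matrix κ κ ℂ) : EReal :=
  ⨆ (R : ℕ) (ρ : Matrix (Fin R × ι) (Fin R × ι) ℂ) (_ : IsDensity ρ),
    D (Fin R × κ) (idTensor N ρ) (idTensor M ρ)

/-- The amortized channel divergence `D^𝒜(N‖M)`. -/
def amortizedDiv (D : DivFam) {ι κ : Type} [Fintype ι] [DecidableEq ι] [Fintype κ] [DecidableEq κ]
    (N M : Matrix ι ι ℂ → Matrix κ κ ℂ) : EReal :=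
  ⨆ (R : ℕ) (ρ : Matrix (Fin R × ι) (Fin R × ι) ℂ) (σ : Matrix (Fin R × ι) (Fin R × ι) ℂ)
    (_ : IsDensity ρ) (_ : IsDensity σ),
      D (Fin R × κ) (idTensor N ρ) (idTensor M σ) - D (Fin R × ι) ρ σ

/-- Apply a real function to a Hermitian matrix via the spectral decomposition. -/
def hermFun {ι : Type} [Fintype ι] [DecidableEq ι] (f : ℝ → ℝ) (A : Matrix ι ι ℂ) :
    Matrix ι ι ℂ :=
  if hA : A.IsHermitian then
    (hA.eigenvectorUnitary : Matrix ι ι ℂ) *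
      Matrix.diagonal (fun i => (f (hA.eigenvalues i) : ℂ)) *
      star (hA.eigenvectorUnitary : Matrix ι ι ℂ)
  else 0

/-- Real matrix power via spectral calculus, with the generalized-inverse convention `0 ↦ 0`. -/
def matPow {ι : Type} [Fintype ι] [DecidableEq ι] (A : Matrix ι ι ℂ) (r : ℝ) : Matrix ι ι ℂ :=
  hermFun (fun x => if x = 0 then 0 else Real.rpow x r) A

/-- Matrix base-2 logarithm via spectral calculus, taken on the support. -/
def matLog2 {ι : Type} [Fintype ι] [DecidableEq ι] (A : Matrix ι ι ℂ) : Matrix ι ι ℂ :=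
  hermFun (fun x => if x = 0 then 0 else Real.logb 2 x) A

/-- The projection onto the support of a Hermitian matrix. -/
def suppProj {ι : Type} [Fintype ι] [DecidableEq ι] (A : Matrix ι ι ℂ) : Matrix ι ι ℂ :=
  hermFun (fun x => if x = 0 then 0 else 1) A

/-- `supp ρ ⊆ supp σ`, expressed (for Hermitian matrices) as kernel containment
`ker σ ⊆ ker ρ`. -/
def suppLE {ι : Type} [Fintype ι] (ρ σ : Matrix ι ι ℂ) : Prop :=
  ∀ v : ι → ℂ, σ.mulVec v = 0 → ρ.mulVec v = 0

/-- The quantum relative entropy `D(ρ‖σ) = Tr[ρ(log₂ρ − log₂σ)]`,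
`+∞` if the support condition fails. -/
def relEnt {ι : Type} [Fintype ι] [DecidableEq ι] (ρ σ : Matrix ι ι ℂ) : EReal :=
  if suppLE ρ σ then (((ρ * (matLog2 ρ - matLog2 σ)).trace).re : EReal) else ⊤

/-- `−log₂ x` as an extended real, with `−log₂ 0 = +∞`. -/
def negLog2 (x : ℝ) : EReal :=
  if x ≤ 0 then ⊤ else ((-Real.logb 2 x : ℝ) : EReal)

/-- The max-relative entropy `D_max(ρ‖σ) = inf{λ : ρ ≤ 2^λ σ}` (Loewner order). -/
def Dmax {ι : Type} [Fintype ι] (ρ σ : Matrix ι ι ℂ) : EReal :=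
  ⨅ (l : ℝ) (_ : (((2 : ℝ) ^ l) • σ - ρ).PosSemidef), (l : EReal)

/-- The sandwiched Rényi divergence `D̃_α`. -/
def sandRenyi {ι : Type} [Fintype ι] [DecidableEq ι] (α : ℝ) (ρ σ : Matrix ι ι ℂ) : EReal :=
  if α = 1 then relEnt ρ σ
  else if 1 < α ∧ ¬ suppLE ρ σ then ⊤
  else if α < 1 ∧ (ρ * σ).trace = 0 then ⊤
  else ((((α - 1)⁻¹ *
      Real.logb 2
        (((matPow (matPow σ ((1 - α) / (2 * α)) * ρ * matPow σ ((1 - α) / (2 * α))) α).trace).re)) :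
        ℝ) : EReal)

/-- The Petz–Rényi divergence `D_α`. -/
def petzRenyi {ι : Type} [Fintype ι] [DecidableEq ι] (α : ℝ) (ρ σ : Matrix ι ι ℂ) : EReal :=
  if α = 0 then negLog2 (((suppProj ρ * σ).trace).re)
  else if α = 1 then relEnt ρ σ
  else if 1 < α ∧ ¬ suppLE ρ σ then ⊤
  else if α < 1 ∧ (ρ * σ).trace = 0 then ⊤
  else ((((α - 1)⁻¹ * Real.logb 2 (((matPow ρ α * matPow σ (1 - α)).trace).re)) : ℝ) : EReal)

/-- The trace norm `‖X‖₁ = Tr √(XᴴX)`. -/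
def traceNorm {ι : Type} [Fintype ι] [DecidableEq ι] (X : Matrix ι ι ℂ) : ℝ :=
  ((matPow (X.conjTranspose * X) (1/2 : ℝ)).trace).re

/-- The fidelity `F(ρ,σ) = ‖√ρ√σ‖₁²`. -/
def matFidelity {ι : Type} [Fintype ι] [DecidableEq ι] (ρ σ : Matrix ι ι ℂ) : ℝ :=
  (traceNorm (matPow ρ (1/2 : ℝ) * matPow σ (1/2 : ℝ))) ^ 2

def relEntFam : DivFam := fun _ _ _ ρ σ => relEnt ρ σ
def DmaxFam : DivFam := fun _ _ _ ρ σ => Dmax ρ σ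
def sandFam (α : ℝ) : DivFam := fun _ _ _ ρ σ => sandRenyi α ρ σ
def petzFam (α : ℝ) : DivFam := fun _ _ _ ρ σ => petzRenyi α ρ σ
/-- `D̃_{1/2}(ρ‖σ) = −log₂ F(ρ,σ)` as a divergence family. -/
def fidDivFam : DivFam := fun _ _ _ ρ σ => negLog2 (matFidelity ρ σ)

/-- The classical-quantum state `Σ_x p(x) |x⟩⟨x| ⊗ ρ^x`. -/
def cqState {X ι : Type} [DecidableEq X] (p : X → ℝ) (ρ : X → Matrix ι ι ℂ) :
    Matrix (X × ι) (X × ι) ℂ :=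
  fun a b => if a.1 = b.1 then (p a.1 : ℂ) * ρ a.1 a.2 b.2 else 0

/-- The direct-sum property of a generalized divergence on classical-quantum states. -/
def DivDirectSum (D : DivFam) : Prop :=
  ∀ (X ι : Type) [Fintype X] [DecidableEq X] [Fintype ι] [DecidableEq ι]
    (p : X → ℝ), (∀ x, 0 ≤ p x) → (∑ x, p x = 1) →
    ∀ (ρ σ : X → Matrix ι ι ℂ), (∀ x, IsDensity (ρ x)) → (∀ x, IsDensity (σ x)) →
      D (X × ι) (cqState p ρ) (cqState p σ) = ∑ x, (p x : EReal) * D ι (ρ x) (σ x)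

/-- The Kronecker (tensor) product of square matrices. -/
def mkron {ι E : Type} (A : Matrix ι ι ℂ) (B : Matrix E E ℂ) : Matrix (ι × E) (ι × E) ℂ :=
  fun p q => A p.1 q.1 * B p.2 q.2

/-- Sub-additivity of a divergence with respect to tensor-product states. -/
def DivSubAdditive (D : DivFam) : Prop :=
  ∀ (ι E : Type) [Fintype ι] [DecidableEq ι] [Fintype E] [DecidableEq E]
    (ρ σ : Matrix ι ι ℂ) (ω τ : Matrix E E ℂ),
    IsDensity ρ → IsDensity σ → IsDensity ω → IsDensity τ →
      D (ι × E) (mkron ρ ω) (mkron σ τ) ≤ D ι ρ σ + D E ω τ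

/-- The classical-quantum channel `ρ ↦ Σ_x ⟨x|ρ|x⟩ ν^x`. -/
def cqChannel {X κ : Type} [Fintype X] [Fintype κ] (ν : X → Matrix κ κ ℂ) :
    Matrix X X ℂ → Matrix κ κ ℂ :=
  fun ρ => ∑ x, ρ x x • ν x

/-- The maximally entangled state of Schmidt rank `|ι|` on `ι × ι`. -/
def maxEnt (ι : Type) [Fintype ι] [DecidableEq ι] : Matrix (ι × ι) (ι × ι) ℂ :=
  fun p q => if p.1 = p.2 ∧ q.1 = q.2 then ((Fintype.card ι : ℂ))⁻¹ else 0

/-- An `(m+1)`-round adaptive channel discrimination protocol: registers `R_0, …, R_m`,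
a shared initial state, adaptive channels between channel uses, and a final measurement. -/
structure Protocol (ι κ : Type) [Fintype ι] [DecidableEq ι] [Fintype κ] [DecidableEq κ]
    (m : ℕ) where
  r : ℕ → ℕ
  init : Matrix (Fin (r 0) × ι) (Fin (r 0) × ι) ℂ
  init_density : IsDensity init
  adapt : ∀ i : ℕ, Matrix (Fin (r i) × κ) (Fin (r i) × κ) ℂ →
      Matrix (Fin (r (i + 1)) × ι) (Fin (r (i + 1)) × ι) ℂ
  adapt_channel : ∀ i, i < m → IsChannel (adapt i)
  meas : Matrix (Fin (r m) × κ) (Fin (r m) × κ) ℂ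
  meas_psd : meas.PosSemidef
  meas_le_one : ((1 : Matrix (Fin (r m) × κ) (Fin (r m) × κ) ℂ) - meas).PosSemidef

namespace Protocol

variable {ι κ : Type} [Fintype ι] [DecidableEq ι] [Fintype κ] [DecidableEq κ] {m : ℕ}

/-- The state on `R_i ⊗ A` just before the `(i+1)`-st channel use, when the channel is `Ch`. -/
def evolve (P : Protocol ι κ m) (Ch : Matrix ι ι ℂ → Matrix κ κ ℂ) :
    (i : ℕ) → Matrix (Fin (P.r i) × ι) (Fin (P.r i) × ι) ℂ
  | 0 => P.init
  | (i + 1) => P.adapt i (idTensor Ch (P.evolve Ch i))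

/-- The final state on `R_m ⊗ B` after all `m + 1` channel uses. -/
def final (P : Protocol ι κ m) (Ch : Matrix ι ι ℂ → Matrix κ κ ℂ) :
    Matrix (Fin (P.r m) × κ) (Fin (P.r m) × κ) ℂ :=
  idTensor Ch (P.evolve Ch m)

/-- The probability of accepting (deciding for the null hypothesis). -/
def acceptProb (P : Protocol ι κ m) (Ch : Matrix ι ι ℂ → Matrix κ κ ℂ) : ℝ :=
  ((P.meas * P.final Ch).trace).re

/-- The type I error probability `Tr[(I − Q) ρ'⁽ⁿ⁾]`. -/
def typeI (P : Protocol ι κ m) (N : Matrix ι ι ℂ → Matrix κ κ ℂ) : ℝ :=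
  ((((1 : Matrix (Fin (P.r m) × κ) (Fin (P.r m) × κ) ℂ) - P.meas) * P.final N).trace).re

/-- The type II error probability `Tr[Q τ'⁽ⁿ⁾]`. -/
def typeII (P : Protocol ι κ m) (M : Matrix ι ι ℂ → Matrix κ κ ℂ) : ℝ :=
  ((P.meas * P.final M).trace).re

end Protocol

/-- The binary (classical) state `diag(p, 1−p)`. -/
def binState (p : ℝ) : Matrix (Fin 2) (Fin 2) ℂ :=
  Matrix.diagonal (fun i => if i = 0 then (p : ℂ) else ((1 - p : ℝ) : ℂ))

/-- The binary entropy `h₂(ε)`. -/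
def h2 (ε : ℝ) : ℝ := -(ε * Real.logb 2 ε) - (1 - ε) * Real.logb 2 (1 - ε)

/-- `ζ_n(ε, N, M)` with `n = m + 1`: the optimal type II error exponent among all
`(m+1)`-round adaptive protocols with type I error at most `ε`. -/
def steinExp {ι κ : Type} [Fintype ι] [DecidableEq ι] [Fintype κ] [DecidableEq κ]
    (N M : Matrix ι ι ℂ → Matrix κ κ ℂ) (m : ℕ) (ε : ℝ) : EReal :=
  ⨆ (P : Protocol ι κ m) (_ : P.typeI N ≤ ε),
    (((m + 1 : ℝ))⁻¹ : EReal) * negLog2 (P.typeII M)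

/-- Partial trace over the (left) reference system. -/
def ptraceLeft {R ι : Type} [Fintype R] (ψ : Matrix (R × ι) (R × ι) ℂ) : Matrix ι ι ℂ :=
  fun a b => ∑ r, ψ (r, a) (r, b)

/-- The energy-constrained generalized channel divergence. -/
def eChannelDiv (D : DivFam) {ι κ : Type} [Fintype ι] [DecidableEq ι] [Fintype κ] [DecidableEq κ]
    (H : Matrix ι ι ℂ) (E : ℝ) (N M : Matrix ι ι ℂ → Matrix κ κ ℂ) : EReal :=
  ⨆ (R : ℕ) (ψ : Matrix (Fin R × ι) (Fin R × ι) ℂ) (_ : IsDensity ψ)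
    (_ : ((H * ptraceLeft ψ).trace).re ≤ E),
      D (Fin R × κ) (idTensor N ψ) (idTensor M ψ)

/-- The energy-constrained amortized channel divergence. -/
def eAmortizedDiv (D : DivFam) {ι κ : Type} [Fintype ι] [DecidableEq ι] [Fintype κ] [DecidableEq κ]
    (H : Matrix ι ι ℂ) (E : ℝ) (N M : Matrix ι ι ℂ → Matrix κ κ ℂ) : EReal :=
  ⨆ (R : ℕ) (ρ : Matrix (Fin R × ι) (Fin R × ι) ℂ) (σ : Matrix (Fin R × ι) (Fin R × ι) ℂ)
    (_ : IsDensity ρ) (_ : IsDensity σ)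
    (_ : ((H * ptraceLeft ρ).trace).re ≤ E) (_ : ((H * ptraceLeft σ).trace).re ≤ E),
      D (Fin R × κ) (idTensor N ρ) (idTensor M σ) - D (Fin R × ι) ρ σ

/-- `sup_α(ρ/σ)`: supremum of `Tr[Λρ]/Tr[Λσ]` over Hermitian `Λ` with `α⁻¹ I ≤ Λ ≤ I`. -/
def hilbertSup {ι : Type} [Fintype ι] [DecidableEq ι] (α : ℝ) (ρ σ : Matrix ι ι ℂ) : ℝ :=
  sSup { t : ℝ | ∃ Λ : Matrix ι ι ℂ, Λ.IsHermitian ∧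
    (Λ - (α⁻¹ : ℝ) • (1 : Matrix ι ι ℂ)).PosSemidef ∧
    ((1 : Matrix ι ι ℂ) - Λ).PosSemidef ∧
    t = ((Λ * ρ).trace).re / ((Λ * σ).trace).re }

/-- The Hilbert `α`-divergence `H_α(ρ‖σ)`, with `H₁(ρ‖σ) = ‖ρ−σ‖₁ / (2 ln 2)`. -/
def hilbertDiv {ι : Type} [Fintype ι] [DecidableEq ι] (α : ℝ) (ρ σ : Matrix ι ι ℂ) : ℝ :=
  if α = 1 then (2 * Real.log 2)⁻¹ * traceNorm (ρ - σ)
  else (α / (α - 1)) * Real.logb 2 (hilbertSup α ρ σ)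

open scoped Matrix Kronecker

section SpectralCalculus

variable {ι κ : Type} [Fintype ι] [DecidableEq ι] [Fintype κ] [DecidableEq κ]

/-- Complex-valued spectral calculus of a Hermitian matrix. -/
def specFun (f : ℝ → ℂ) (A : Matrix ι ι ℂ) : Matrix ι ι ℂ :=
  if hA : A.IsHermitian then
    (hA.eigenvectorUnitary : Matrix ι ι ℂ) *
      Matrix.diagonal (fun i => f (hA.eigenvalues i)) *
      star (hA.eigenvectorUnitary : Matrix ι ι ℂ)
  else 0

lemma hermFun_eq_specFun (f : ℝ → ℝ) (A : Matrix ι ι ℂ) :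
    hermFun f A = specFun (fun x => (f x : ℂ)) A := rfl

lemma Matrix.IsHermitian.eq_unitary_diagonal {A : Matrix ι ι ℂ} (hA : A.IsHermitian) :
    A = (hA.eigenvectorUnitary : Matrix ι ι ℂ) *
      Matrix.diagonal (fun i => (hA.eigenvalues i : ℂ)) *
      star (hA.eigenvectorUnitary : Matrix ι ι ℂ) := by
  conv_lhs => rw [hA.spectral_theorem, Unitary.conjStarAlgAut_apply]
  rfl

lemma Matrix.PosSemidef.exists_unitary_diagonal {A : Matrix ι ι ℂ} (hA : A.PosSemidef) :
    ∃ (U : Matrix ι ι ℂ) (d : ι → ℝ), U * Uᴴ = 1 ∧ Uᴴ * U = 1 ∧ (∀ i, 0 ≤ d i) ∧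
      A = U * Matrix.diagonal (fun i => (d i : ℂ)) * Uᴴ :=
  ⟨hA.1.eigenvectorUnitary, hA.1.eigenvalues,
    Unitary.mul_star_self_of_mem hA.1.eigenvectorUnitary.2,
    Unitary.star_mul_self_of_mem hA.1.eigenvectorUnitary.2,
    hA.eigenvalues_nonneg, hA.1.eq_unitary_diagonal⟩

/-- The spectral calculus may be computed in any diagonalization. -/
lemma specFun_unitary_diagonal (f : ℝ → ℂ) {U : Matrix ι ι ℂ} (h₁ : U * Uᴴ = 1)
    (h₂ : Uᴴ * U = 1) (d : ι → ℝ) :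
    specFun f (U * Matrix.diagonal (fun i => (d i : ℂ)) * Uᴴ) =
      U * Matrix.diagonal (fun i => f (d i)) * Uᴴ := by
  set A := U * Matrix.diagonal (fun i => (d i : ℂ)) * Uᴴ with hAdef
  have hA : A.IsHermitian := by
    refine Matrix.isHermitian_mul_mul_conjTranspose U ?_
    exact Matrix.isHermitian_diagonal_of_self_adjoint _ (by ext i; simp)
  rw [specFun, dif_pos hA]
  set V := (hA.eigenvectorUnitary : Matrix ι ι ℂ)
  have hV₁ : V * star V = 1 := Unitary.mul_star_self_of_mem hA.eigenvectorUnitary.2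
  have hV₂ : star V * V = 1 := Unitary.star_mul_self_of_mem hA.eigenvectorUnitary.2
  have hd : A = V * Matrix.diagonal (fun i => (hA.eigenvalues i : ℂ)) * star V :=
    hA.eq_unitary_diagonal
  have hW : Matrix.diagonal (fun i => (d i : ℂ)) * (Uᴴ * V) =
      (Uᴴ * V) * Matrix.diagonal (fun i => (hA.eigenvalues i : ℂ)) := by
    calc _ = Uᴴ * (U * Matrix.diagonal (fun i => (d i : ℂ)) * Uᴴ) * V := by
          simp only [Matrix.mul_assoc]; rw [← Matrix.mul_assoc Uᴴ U, h₂, Matrix.one_mul]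
      _ = Uᴴ * (V * Matrix.diagonal (fun i => (hA.eigenvalues i : ℂ)) * star V) * V := by
          rw [← hAdef, ← hd]
      _ = _ := by simp only [Matrix.mul_assoc]; rw [hV₂, Matrix.mul_one]
  have hfW : Matrix.diagonal (fun i => f (d i)) * (Uᴴ * V) =
      (Uᴴ * V) * Matrix.diagonal (fun i => f (hA.eigenvalues i)) := by
    ext i j
    have := congrFun (congrFun hW i) j
    rw [Matrix.diagonal_mul, Matrix.mul_diagonal] at this ⊢
    by_cases h0 : (Uᴴ * V) i j = 0
    · simp [h0]
    · rw [mul_comm] at this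
      have h := mul_left_cancel₀ h0 this
      rw [Complex.ofReal_inj.mp h, mul_comm]
  calc _ = U * (Uᴴ * V * Matrix.diagonal (fun i => f (hA.eigenvalues i))) * star V := by
        simp only [← Matrix.mul_assoc]; rw [h₁, Matrix.one_mul]
    _ = _ := by
        rw [← hfW]; simp only [Matrix.mul_assoc]; rw [hV₁, Matrix.mul_one]

lemma specFun_mul (f g : ℝ → ℂ) (A : Matrix ι ι ℂ) :
    specFun f A * specFun g A = specFun (fun x => f x * g x) A := by
  unfold specFun
  split_ifs with hA
  · set V := (hA.eigenvectorUnitary : Matrix ι ι ℂ)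
    have hV : star V * V = 1 := Unitary.star_mul_self_of_mem hA.eigenvectorUnitary.2
    simp only [Matrix.mul_assoc]
    rw [← Matrix.mul_assoc (star V) V, hV, Matrix.one_mul,
      ← Matrix.mul_assoc (Matrix.diagonal _) (Matrix.diagonal _), Matrix.diagonal_mul_diagonal]
  · simp

lemma specFun_conjTranspose (f : ℝ → ℂ) (A : Matrix ι ι ℂ) :
    (specFun f A)ᴴ = specFun (fun x => star (f x)) A := by
  unfold specFun
  split_ifs with hA
  · simp [Matrix.star_eq_conjTranspose, Matrix.mul_assoc, Matrix.diagonal_conjTranspose]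
    rfl
  · simp

lemma specFun_congr {f g : ℝ → ℂ} {A : Matrix ι ι ℂ} (hA : A.PosSemidef)
    (h : ∀ x, 0 ≤ x → f x = g x) : specFun f A = specFun g A := by
  unfold specFun
  rw [dif_pos hA.1, dif_pos hA.1]
  simp only [fun i => h _ (hA.eigenvalues_nonneg i)]

lemma specFun_id {A : Matrix ι ι ℂ} (hA : A.IsHermitian) :
    specFun (fun x => (x : ℂ)) A = A := by
  rw [specFun, dif_pos hA, ← hA.eq_unitary_diagonal]

lemma specFun_kronecker {f : ℝ → ℂ} (hf : ∀ x y, 0 ≤ x → 0 ≤ y → f (x * y) = f x * f y)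
    {A : Matrix ι ι ℂ} {B : Matrix κ κ ℂ} (hA : A.PosSemidef) (hB : B.PosSemidef) :
    specFun f (A ⊗ₖ B) = specFun f A ⊗ₖ specFun f B := by
  obtain ⟨U, d, hU₁, hU₂, hd, rfl⟩ := hA.exists_unitary_diagonal
  obtain ⟨V, e, hV₁, hV₂, he, rfl⟩ := hB.exists_unitary_diagonal
  have key : ∀ a : ι → ℂ, ∀ b : κ → ℂ,
      (U * Matrix.diagonal a * Uᴴ) ⊗ₖ (V * Matrix.diagonal b * Vᴴ) =
      (U ⊗ₖ V) * Matrix.diagonal (fun p : ι × κ => a p.1 * b p.2) * (U ⊗ₖ V)ᴴ := by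
    intro a b
    rw [Matrix.mul_kronecker_mul, Matrix.mul_kronecker_mul, Matrix.conjTranspose_kronecker,
      Matrix.diagonal_kronecker_diagonal]
  rw [specFun_unitary_diagonal f hU₁ hU₂, specFun_unitary_diagonal f hV₁ hV₂, key, key]
  have := specFun_unitary_diagonal f (U := U ⊗ₖ V)
    (by rw [Matrix.conjTranspose_kronecker, ← Matrix.mul_kronecker_mul, hU₁, hV₁,
      Matrix.one_kronecker_one])
    (by rw [Matrix.conjTranspose_kronecker, ← Matrix.mul_kronecker_mul, hU₂, hV₂,
      Matrix.one_kronecker_one]) (fun p => d p.1 * e p.2)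
  simp only [Complex.ofReal_mul] at this
  rw [this]
  simp only [fun p : ι × κ => hf _ _ (hd p.1) (he p.2)]

lemma specFun_blockDiagonal (f : ℝ → ℂ) {A : κ → Matrix ι ι ℂ} (hA : ∀ x, (A x).PosSemidef) :
    specFun f (Matrix.blockDiagonal A) = Matrix.blockDiagonal (fun x => specFun f (A x)) := by
  choose U d hU₁ hU₂ hd h using fun x => (hA x).exists_unitary_diagonal
  have hA' : A = fun x => U x * Matrix.diagonal (fun i => (d x i : ℂ)) * (U x)ᴴ := funext h
  have key : ∀ a : κ → ι → ℂ,
      Matrix.blockDiagonal (fun x => U x * Matrix.diagonal (a x) * (U x)ᴴ) =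
      Matrix.blockDiagonal U * Matrix.diagonal (fun p : ι × κ => a p.2 p.1) *
        (Matrix.blockDiagonal U)ᴴ := by
    intro a
    rw [Matrix.blockDiagonal_mul, Matrix.blockDiagonal_mul, Matrix.blockDiagonal_conjTranspose,
      Matrix.blockDiagonal_diagonal]
  have hf : (fun x => specFun f (A x)) =
      fun x => U x * Matrix.diagonal (fun i => f (d x i)) * (U x)ᴴ := by
    ext1 x
    rw [h x, specFun_unitary_diagonal f (hU₁ x) (hU₂ x)]
  have h₁ : Matrix.blockDiagonal U * (Matrix.blockDiagonal U)ᴴ = 1 := by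
    rw [Matrix.blockDiagonal_conjTranspose, ← Matrix.blockDiagonal_mul, funext hU₁]
    exact Matrix.blockDiagonal_one
  have h₂ : (Matrix.blockDiagonal U)ᴴ * Matrix.blockDiagonal U = 1 := by
    rw [Matrix.blockDiagonal_conjTranspose, ← Matrix.blockDiagonal_mul, funext hU₂]
    exact Matrix.blockDiagonal_one
  rw [hf, hA', key, key, specFun_unitary_diagonal f h₁ h₂ (fun p : ι × κ => d p.2 p.1)]

lemma specFun_submatrix (f : ℝ → ℂ) {A : Matrix ι ι ℂ} (hA : A.PosSemidef) (e : κ ≃ ι) :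
    specFun f (A.submatrix e e) = (specFun f A).submatrix e e := by
  obtain ⟨U, d, hU₁, hU₂, hd, rfl⟩ := hA.exists_unitary_diagonal
  have key : ∀ a : ι → ℂ, (U * Matrix.diagonal a * Uᴴ).submatrix e e =
      U.submatrix e e * Matrix.diagonal (a ∘ e) * (U.submatrix e e)ᴴ := by
    intro a
    rw [Matrix.conjTranspose_submatrix, ← Matrix.submatrix_diagonal_equiv,
      Matrix.submatrix_mul_equiv, Matrix.submatrix_mul_equiv]
  rw [specFun_unitary_diagonal f hU₁ hU₂, key, key]
  exact specFun_unitary_diagonal f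
    (by rw [Matrix.conjTranspose_submatrix, Matrix.submatrix_mul_equiv, hU₁,
      Matrix.submatrix_one_equiv])
    (by rw [Matrix.conjTranspose_submatrix, Matrix.submatrix_mul_equiv, hU₂,
      Matrix.submatrix_one_equiv]) (d ∘ e)

end SpectralCalculus

section ComplexPower

variable {ι κ : Type} [Fintype ι] [DecidableEq ι] [Fintype κ] [DecidableEq κ]

/-- Complex matrix power on the support, with the convention `0 ↦ 0`. -/
def matCpow (A : Matrix ι ι ℂ) (z : ℂ) : Matrix ι ι ℂ :=
  specFun (fun x => if x = 0 then 0 else (x : ℂ) ^ z) A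

lemma matPow_eq_matCpow {A : Matrix ι ι ℂ} (hA : A.PosSemidef) (r : ℝ) :
    matPow A r = matCpow A r := by
  rw [matPow, hermFun_eq_specFun, matCpow]
  refine specFun_congr hA fun x hx => ?_
  split_ifs
  · simp
  · exact Complex.ofReal_cpow hx r

lemma matCpow_mul (A : Matrix ι ι ℂ) (z w : ℂ) :
    matCpow A z * matCpow A w = matCpow A (z + w) := by
  rw [matCpow, matCpow, specFun_mul, matCpow]
  congr 1
  ext x
  split_ifs with h
  · simp
  · rw [Complex.cpow_add _ _ (by exact_mod_cast h)]

lemma matCpow_mul_mul {m : Type} (A : Matrix ι ι ℂ) (z w : ℂ) (M : Matrix ι m ℂ) :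
    matCpow A z * (matCpow A w * M) = matCpow A (z + w) * M := by
  rw [← Matrix.mul_assoc, matCpow_mul]

lemma matCpow_conjTranspose {A : Matrix ι ι ℂ} (hA : A.PosSemidef) (z : ℂ) :
    (matCpow A z)ᴴ = matCpow A (star z) := by
  rw [matCpow, specFun_conjTranspose, matCpow]
  refine specFun_congr hA fun x hx => ?_
  split_ifs
  · simp
  · have := Complex.cpow_conj (x : ℂ) z (by
      rw [Complex.arg_ofReal_of_nonneg hx]; exact Real.pi_pos.ne)
    rw [Complex.conj_ofReal] at this
    exact this.symm

lemma matCpow_one {A : Matrix ι ι ℂ} (hA : A.PosSemidef) : matCpow A 1 = A := by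
  conv_rhs => rw [← specFun_id hA.1]
  rw [matCpow]
  refine specFun_congr hA fun x hx => ?_
  split_ifs with h <;> simp [h]

lemma matCpow_zero_mul_self {A : Matrix ι ι ℂ} (hA : A.PosSemidef) : matCpow A 0 * A = A := by
  conv_lhs => enter [2]; rw [← matCpow_one hA]
  rw [matCpow_mul, zero_add, matCpow_one hA]

lemma matCpow_ofReal_conjTranspose {A : Matrix ι ι ℂ} (hA : A.PosSemidef) (r : ℝ) :
    (matCpow A (r : ℂ))ᴴ = matCpow A r := by
  rw [matCpow_conjTranspose hA]; simp

lemma matCpow_zero_conjTranspose {A : Matrix ι ι ℂ} (hA : A.PosSemidef) :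
    (matCpow A 0)ᴴ = matCpow A 0 := by
  rw [matCpow_conjTranspose hA]; simp

lemma matCpow_posSemidef {A : Matrix ι ι ℂ} (hA : A.PosSemidef) (r : ℝ) :
    (matCpow A (r : ℂ)).PosSemidef := by
  have h : matCpow A (r : ℂ) = (matCpow A ((r / 2 : ℝ) : ℂ))ᴴ * matCpow A ((r / 2 : ℝ) : ℂ) := by
    rw [matCpow_ofReal_conjTranspose hA, matCpow_mul]; congr 1; push_cast; ring
  rw [h]
  exact Matrix.posSemidef_conjTranspose_mul_self _

lemma matCpow_kronecker {A : Matrix ι ι ℂ} {B : Matrix κ κ ℂ} (hA : A.PosSemidef)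
    (hB : B.PosSemidef) (z : ℂ) : matCpow (A ⊗ₖ B) z = matCpow A z ⊗ₖ matCpow B z := by
  refine specFun_kronecker (fun x y hx hy => ?_) hA hB
  by_cases h : x = 0
  · simp [h]
  by_cases h' : y = 0
  · simp [h']
  rw [if_neg (mul_ne_zero h h'), if_neg h, if_neg h', Complex.ofReal_mul,
    Complex.mul_cpow_ofReal_nonneg hx hy]

lemma matCpow_blockDiagonal {A : κ → Matrix ι ι ℂ} (hA : ∀ x, (A x).PosSemidef) (z : ℂ) :
    matCpow (Matrix.blockDiagonal A) z = Matrix.blockDiagonal (fun x => matCpow (A x) z) :=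
  specFun_blockDiagonal _ hA

omit [DecidableEq ι] in
lemma posSemidef_trace_eq_re {A : Matrix ι ι ℂ} (hA : A.PosSemidef) :
    A.trace = ((A.trace).re : ℂ) := by
  have := (Complex.nonneg_iff.mp hA.trace_nonneg).2
  exact Complex.ext rfl (by simpa using this.symm)

lemma posSemidef_blockDiagonal {A : κ → Matrix ι ι ℂ} (hA : ∀ x, (A x).PosSemidef) :
    (Matrix.blockDiagonal A).PosSemidef := by
  have h : Matrix.blockDiagonal A = (Matrix.blockDiagonal (fun x => matCpow (A x) (1 / 2)))ᴴ *
      Matrix.blockDiagonal (fun x => matCpow (A x) (1 / 2)) := by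
    rw [Matrix.blockDiagonal_conjTranspose, ← Matrix.blockDiagonal_mul]
    congr 1
    ext1 x
    have := matCpow_ofReal_conjTranspose (hA x) (1 / 2)
    push_cast at this
    rw [this, matCpow_mul]
    norm_num [matCpow_one (hA x)]
  rw [h]
  exact Matrix.posSemidef_conjTranspose_mul_self _

end ComplexPower

section Frobenius

variable {ι κ m n J : Type} [Fintype ι] [DecidableEq ι] [Fintype κ] [DecidableEq κ]
  [Fintype m] [Fintype n] [Fintype J]

/-- The squared Frobenius norm. -/
def frobSq (M : Matrix m n ℂ) : ℝ := (Mᴴ * M).trace.re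

lemma frobSq_eq_sum (M : Matrix m n ℂ) : frobSq M = ∑ i, ∑ j, ‖M i j‖ ^ 2 := by
  rw [Finset.sum_comm]
  simp only [frobSq, Matrix.trace, Matrix.diag, Matrix.mul_apply, Matrix.conjTranspose_apply,
    Complex.re_sum]
  refine Finset.sum_congr rfl fun j _ => Finset.sum_congr rfl fun i _ => ?_
  have := Complex.conj_mul' (M i j)
  rw [Complex.star_def, this]
  norm_cast

lemma frobSq_nonneg (M : Matrix m n ℂ) : 0 ≤ frobSq M := by
  rw [frobSq_eq_sum]; positivity

lemma frobSq_conjTranspose (M : Matrix m n ℂ) : frobSq Mᴴ = frobSq M := by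
  rw [frobSq, frobSq, Matrix.conjTranspose_conjTranspose, Matrix.trace_mul_comm]

/-- Cauchy–Schwarz for the Frobenius inner product of families of matrices. -/
lemma norm_sum_trace_mul_le (P : J → Matrix m n ℂ) (Q : J → Matrix n m ℂ) {a b : ℝ}
    (ha : ∑ j, frobSq (P j) ≤ a) (hb : ∑ j, frobSq (Q j) ≤ b) :
    ‖∑ j, (P j * Q j).trace‖ ≤ √a * √b := by
  have h₁ : ∑ j, (P j * Q j).trace =
      ∑ t : J × m × n, P t.1 t.2.1 t.2.2 * Q t.1 t.2.2 t.2.1 := by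
    simp [Fintype.sum_prod_type, Matrix.trace, Matrix.mul_apply]
  have h₂ : ∑ j, frobSq (P j) = ∑ t : J × m × n, ‖P t.1 t.2.1 t.2.2‖ ^ 2 := by
    simp [Fintype.sum_prod_type, frobSq_eq_sum]
  have h₃ : ∑ j, frobSq (Q j) = ∑ t : J × m × n, ‖Q t.1 t.2.2 t.2.1‖ ^ 2 := by
    simp only [Fintype.sum_prod_type, frobSq_eq_sum]
    exact Finset.sum_congr rfl fun j _ => Finset.sum_comm
  rw [h₁]
  calc _ ≤ ∑ t : J × m × n, ‖P t.1 t.2.1 t.2.2‖ * ‖Q t.1 t.2.2 t.2.1‖ :=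
        (norm_sum_le _ _).trans_eq (by simp only [norm_mul])
    _ ≤ _ := Real.sum_mul_le_sqrt_mul_sqrt _ _ _
    _ ≤ _ := by
        rw [← h₂, ← h₃]
        gcongr

lemma frobSq_matCpow_zero_mul_le {A : Matrix ι ι ℂ} (hA : A.PosSemidef) (M : Matrix ι n ℂ) :
    frobSq (matCpow A 0 * M) ≤ frobSq M := by
  set P := matCpow A 0 with hP
  have hPP : P * P = P := by rw [hP, matCpow_mul, add_zero]
  have hPH : Pᴴ = P := matCpow_zero_conjTranspose hA
  have h : frobSq M = frobSq (P * M) + frobSq ((1 - P) * M) := by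
    simp only [frobSq, Matrix.conjTranspose_mul, Matrix.conjTranspose_sub,
      Matrix.conjTranspose_one, hPH]
    rw [← Complex.add_re, ← Matrix.trace_add]
    congr 2
    have h1 : Mᴴ * P * (P * M) = Mᴴ * (P * P) * M := by simp only [Matrix.mul_assoc]
    have h2 : Mᴴ * (1 - P) * ((1 - P) * M) = Mᴴ * ((1 - P) * (1 - P)) * M := by
      simp only [Matrix.mul_assoc]
    have h3 : (1 - P) * (1 - P) = 1 - P := by
      rw [Matrix.sub_mul, Matrix.one_mul, Matrix.mul_sub, Matrix.mul_one, hPP, sub_self, sub_zero]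
    rw [h1, h2, h3, hPP, ← Matrix.add_mul, ← Matrix.mul_add, add_sub_cancel, Matrix.mul_one]
  rw [h]
  exact le_add_of_nonneg_right (frobSq_nonneg _)

lemma frobSq_mul_le_of_gram_eq {A : Matrix ι ι ℂ} (hA : A.PosSemidef) {C : Matrix m ι ℂ}
    (hC : Cᴴ * C = matCpow A 0) (M : Matrix ι n ℂ) : frobSq (C * M) ≤ frobSq M := by
  refine le_trans (le_of_eq ?_) (frobSq_matCpow_zero_mul_le hA M)
  simp only [frobSq, Matrix.conjTranspose_mul, matCpow_zero_conjTranspose hA, Matrix.mul_assoc]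
  rw [matCpow_mul_mul, ← Matrix.mul_assoc Cᴴ, hC, add_zero]

lemma frobSq_matCpow_mul_le {A : Matrix ι ι ℂ} (hA : A.PosSemidef) {z : ℂ} (hz : z.re = 0)
    (M : Matrix ι n ℂ) : frobSq (matCpow A z * M) ≤ frobSq M := by
  refine frobSq_mul_le_of_gram_eq hA ?_ M
  rw [matCpow_conjTranspose hA, matCpow_mul]
  congr 1
  rw [Complex.star_def, add_comm, Complex.add_conj, hz]; simp

lemma frobSq_matCpow {A : Matrix ι ι ℂ} (hA : A.PosSemidef) (z : ℂ) :
    frobSq (matCpow A z) = (matCpow A ((2 * z.re : ℝ) : ℂ)).trace.re := by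
  rw [frobSq, matCpow_conjTranspose hA, matCpow_mul, Complex.star_def, add_comm, Complex.add_conj]

omit [DecidableEq κ] in
/-- Kraus operators of a trace-preserving map do not change the Frobenius norm. -/
lemma sum_frobSq_kraus_mul {K : J → Matrix κ ι ℂ} (hK : ∑ j, (K j)ᴴ * K j = 1)
    (M : Matrix ι n ℂ) : ∑ j, frobSq (K j * M) = frobSq M := by
  simp only [frobSq, Matrix.conjTranspose_mul]
  rw [← Complex.re_sum, ← Matrix.trace_sum]
  congr 2
  have : ∀ j, Mᴴ * (K j)ᴴ * (K j * M) = Mᴴ * ((K j)ᴴ * K j) * M := fun j => by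
    simp only [Matrix.mul_assoc]
  simp only [this]
  rw [← Matrix.sum_mul, ← Matrix.mul_sum, hK, Matrix.mul_one]

lemma sum_frobSq_matCpow_mul {A : Matrix ι ι ℂ} (hA : A.PosSemidef) {G : J → Matrix ι n ℂ}
    (hG : ∑ j, G j * (G j)ᴴ = A) (z : ℂ) :
    ∑ j, frobSq (matCpow A z * G j) = (matCpow A ((2 * z.re + 1 : ℝ) : ℂ)).trace.re := by
  have : ∀ j, frobSq (matCpow A z * G j) =
      (matCpow A z * (G j * (G j)ᴴ) * (matCpow A z)ᴴ).trace.re := fun j => by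
    rw [← frobSq_conjTranspose, frobSq]
    simp only [Matrix.conjTranspose_mul, Matrix.conjTranspose_conjTranspose, Matrix.mul_assoc]
  simp only [this]
  rw [← Complex.re_sum, ← Matrix.trace_sum, ← Matrix.sum_mul, ← Matrix.mul_sum, hG]
  conv_lhs => enter [1, 1, 1, 2]; rw [← matCpow_one hA]
  rw [matCpow_conjTranspose hA, matCpow_mul, matCpow_mul]
  congr 3
  have := Complex.add_conj z
  rw [Complex.star_def, add_right_comm, this]
  push_cast
  ring

lemma matCpow_zero_mul_of_sum {A : Matrix ι ι ℂ} (hA : A.PosSemidef) {G : J → Matrix ι n ℂ}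
    (hG : ∑ j, G j * (G j)ᴴ = A) (j : J) : matCpow A 0 * G j = G j := by
  set P := matCpow A 0 with hP
  have h0 : ∑ j, (((1 - P) * G j) * ((1 - P) * G j)ᴴ).trace = 0 := by
    have : ∀ j, ((1 - P) * G j) * ((1 - P) * G j)ᴴ = (1 - P) * (G j * (G j)ᴴ) * (1 - P)ᴴ := by
      intro j; simp only [Matrix.conjTranspose_mul, Matrix.mul_assoc]
    simp only [this]
    rw [← Matrix.trace_sum, ← Matrix.sum_mul, ← Matrix.mul_sum, hG, Matrix.sub_mul 1 P A,
      matCpow_zero_mul_self hA]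
    simp
  have h1 := (Finset.sum_eq_zero_iff_of_nonneg (fun j _ =>
    (Matrix.posSemidef_self_mul_conjTranspose ((1 - P) * G j)).trace_nonneg)).mp h0 j
    (Finset.mem_univ j)
  rw [Matrix.trace_mul_conjTranspose_self_eq_zero_iff, Matrix.sub_mul, Matrix.one_mul,
    sub_eq_zero] at h1
  exact h1.symm

end Frobenius

section Kraus

variable {ι κ n J : Type} [Fintype ι] [DecidableEq ι] [Fintype κ] [DecidableEq κ]
  [Fintype n] [Fintype J]

/-- The completely positive map with Kraus operators `K`. -/
def krausMap (K : J → Matrix κ ι ℂ) (A : Matrix ι ι ℂ) : Matrix κ κ ℂ := ∑ j, K j * A * (K j)ᴴ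

omit [DecidableEq κ] [DecidableEq ι] in
lemma krausMap_posSemidef (K : J → Matrix κ ι ℂ) {A : Matrix ι ι ℂ} (hA : A.PosSemidef) :
    (krausMap K A).PosSemidef :=
  Matrix.posSemidef_sum _ fun j _ => hA.mul_mul_conjTranspose_same (K j)

lemma matCpow_half_gram {A : Matrix ι ι ℂ} (hA : A.PosSemidef) :
    matCpow A (1 / 2) * (matCpow A (1 / 2))ᴴ = A := by
  have := matCpow_ofReal_conjTranspose hA (1 / 2)
  push_cast at this
  rw [this, matCpow_mul]
  norm_num [matCpow_one hA]

omit [Fintype κ] [DecidableEq κ] in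
lemma sum_kraus_half_gram (K : J → Matrix κ ι ℂ) {A : Matrix ι ι ℂ} (hA : A.PosSemidef) :
    ∑ j, (K j * matCpow A (1 / 2)) * (K j * matCpow A (1 / 2))ᴴ = krausMap K A := by
  refine Finset.sum_congr rfl fun j _ => ?_
  conv_rhs => rw [← matCpow_half_gram hA]
  simp only [Matrix.conjTranspose_mul, Matrix.mul_assoc]

lemma matCpow_krausMap_zero_mul (K : J → Matrix κ ι ℂ) {A : Matrix ι ι ℂ} (hA : A.PosSemidef)
    (z : ℂ) (j : J) :
    matCpow (krausMap K A) 0 * (K j * matCpow A z) = K j * matCpow A z := by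
  have h := matCpow_zero_mul_of_sum (krausMap_posSemidef K hA) (sum_kraus_half_gram K hA) j
  have h2 : K j * matCpow A z = (K j * matCpow A (1 / 2)) * matCpow A (z - 1 / 2) := by
    rw [Matrix.mul_assoc, matCpow_mul]; congr 2; ring
  rw [h2, ← Matrix.mul_assoc, h]

lemma mul_matCpow_krausMap_zero (K : J → Matrix κ ι ℂ) {A : Matrix ι ι ℂ} (hA : A.PosSemidef)
    (z : ℂ) (j : J) :
    matCpow A z * (K j)ᴴ * matCpow (krausMap K A) 0 = matCpow A z * (K j)ᴴ := by
  have h := congrArg Matrix.conjTranspose (matCpow_krausMap_zero_mul K hA (star z) j)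
  rwa [Matrix.conjTranspose_mul, Matrix.conjTranspose_mul, matCpow_conjTranspose hA, star_star,
    matCpow_zero_conjTranspose (krausMap_posSemidef K hA)] at h

/-- At exponent `1/2` the operators `A^{w} Kⱼᴴ Φ(A)^{-w}` form a contraction. -/
lemma sum_frobSq_petz_le (K : J → Matrix κ ι ℂ) {A : Matrix ι ι ℂ} (hA : A.PosSemidef)
    {w v : ℂ} (hw : w.re = 1 / 2) (hv : v = -w) (M : Matrix κ n ℂ) :
    ∑ j, frobSq (matCpow A w * (K j)ᴴ * matCpow (krausMap K A) v * M) ≤ frobSq M := by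
  have hB := krausMap_posSemidef K hA
  refine le_trans (le_of_eq ?_) (frobSq_matCpow_zero_mul_le hB M)
  have hw1 : star w + w = 1 := by
    rw [Complex.star_def, add_comm, Complex.add_conj, hw]; norm_num
  have : ∀ j, frobSq (matCpow A w * (K j)ᴴ * matCpow (krausMap K A) v * M) =
      (Mᴴ * matCpow (krausMap K A) (star v) * (K j * A * (K j)ᴴ) *
        matCpow (krausMap K A) v * M).trace.re := fun j => by
    simp only [frobSq, Matrix.conjTranspose_mul, Matrix.conjTranspose_conjTranspose,
      matCpow_conjTranspose hA, matCpow_conjTranspose hB, Matrix.mul_assoc]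
    rw [matCpow_mul_mul, hw1, matCpow_one hA]
  simp only [this]
  rw [← Complex.re_sum, ← Matrix.trace_sum, ← Matrix.sum_mul, ← Matrix.sum_mul, ← Matrix.mul_sum,
    ← krausMap, frobSq, Matrix.conjTranspose_mul, matCpow_zero_conjTranspose hB]
  have hv1 : star v + 1 + v = 0 := by
    rw [hv, star_neg]; linear_combination -hw1
  congr 2
  conv_lhs => enter [1, 1, 2]; rw [← matCpow_one hB]
  simp only [Matrix.mul_assoc]
  rw [matCpow_mul_mul, matCpow_mul_mul, matCpow_mul_mul, add_zero, hv1]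

end Kraus

section ThreeLines

/-- Entire functions that are bounded on the strip `0 ≤ re z ≤ 1`. -/
def StripBdd (g : ℂ → ℂ) : Prop :=
  Differentiable ℂ g ∧ ∃ C, ∀ z : ℂ, 0 ≤ z.re → z.re ≤ 1 → ‖g z‖ ≤ C

lemma StripBdd.const (c : ℂ) : StripBdd (fun _ => c) :=
  ⟨differentiable_const c, ‖c‖, fun _ _ _ => le_rfl⟩

lemma StripBdd.mul {f g : ℂ → ℂ} (hf : StripBdd f) (hg : StripBdd g) :
    StripBdd (fun z => f z * g z) := by
  obtain ⟨hf, C, hC⟩ := hf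
  obtain ⟨hg, D, hD⟩ := hg
  refine ⟨hf.mul hg, C * D, fun z h0 h1 => ?_⟩
  rw [norm_mul]
  exact mul_le_mul (hC z h0 h1) (hD z h0 h1) (norm_nonneg _) ((norm_nonneg _).trans (hC z h0 h1))

lemma StripBdd.sum {I : Type} [Fintype I] {f : I → ℂ → ℂ} (hf : ∀ i, StripBdd (f i)) :
    StripBdd (fun z => ∑ i, f i z) := by
  choose hd C hC using hf
  refine ⟨Differentiable.fun_sum fun i _ => hd i, ∑ i, C i, fun z h0 h1 => ?_⟩
  exact (norm_sum_le _ _).trans (Finset.sum_le_sum fun i _ => hC i z h0 h1)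

lemma StripBdd.cpow {x : ℝ} (hx : 0 < x) (c d : ℝ) :
    StripBdd (fun z => (x : ℂ) ^ ((c : ℂ) * z + d)) := by
  have hx' : (x : ℂ) ≠ 0 := by exact_mod_cast hx.ne'
  refine ⟨fun z => ?_, ?_⟩
  · exact ((differentiableAt_id.const_mul (c : ℂ)).add_const (d : ℂ)).const_cpow (Or.inl hx')
  · obtain ⟨C, hC⟩ := (isCompact_Icc (a := (0 : ℝ)) (b := 1)).exists_bound_of_continuousOn
      (f := fun t : ℝ => x ^ (c * t + d)) (by
        refine Continuous.continuousOn ?_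
        exact Continuous.rpow continuous_const (by fun_prop) (fun _ => Or.inl hx.ne'))
    refine ⟨C, fun z h0 h1 => ?_⟩
    have := hC z.re ⟨h0, h1⟩
    rw [Complex.norm_cpow_eq_rpow_re_of_pos hx]
    simpa using (le_abs_self _).trans this

/-- Hadamard's three-lines theorem for entire functions bounded on the strip. -/
lemma StripBdd.norm_le {f : ℂ → ℂ} (hf : StripBdd f) {a b t : ℝ} (ht0 : 0 ≤ t) (ht1 : t ≤ 1)
    (ha : ∀ z : ℂ, z.re = 0 → ‖f z‖ ≤ a) (hb : ∀ z : ℂ, z.re = 1 → ‖f z‖ ≤ b) :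
    ‖f t‖ ≤ a ^ (1 - t) * b ^ t := by
  obtain ⟨hd, C, hC⟩ := hf
  have := Complex.HadamardThreeLines.norm_le_interp_of_mem_verticalClosedStrip₀₁' f (z := (t : ℂ))
    (a := a) (b := b) (by simp [Complex.HadamardThreeLines.verticalClosedStrip, ht0, ht1])
    hd.diffContOnCl ⟨C, by rintro _ ⟨z, hz, rfl⟩; exact hC z hz.1 hz.2⟩
    (fun z hz => ha z hz) (fun z hz => hb z hz)
  simpa using this

/-- Matrix-valued functions with entries entire and bounded on the strip. -/
def MatStripBdd {m n : Type} (G : ℂ → Matrix m n ℂ) : Prop :=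
  ∀ i j, StripBdd (fun z => G z i j)

variable {ι κ m n l : Type} [Fintype ι] [DecidableEq ι] [Fintype m] [Fintype n]

omit [Fintype m] [Fintype n] in
lemma MatStripBdd.const (M : Matrix m n ℂ) : MatStripBdd (fun _ => M) :=
  fun _ _ => StripBdd.const _

omit [Fintype m] in
lemma MatStripBdd.mul {F : ℂ → Matrix m n ℂ} {G : ℂ → Matrix n l ℂ} (hF : MatStripBdd F)
    (hG : MatStripBdd G) : MatStripBdd (fun z => F z * G z) := by
  intro i j
  simp only [Matrix.mul_apply]
  exact StripBdd.sum fun k => (hF i k).mul (hG k j)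

lemma MatStripBdd.trace {F : ℂ → Matrix m m ℂ} (hF : MatStripBdd F) :
    StripBdd (fun z => (F z).trace) :=
  StripBdd.sum fun i => hF i i

lemma MatStripBdd.matCpow {A : Matrix ι ι ℂ} (hA : A.PosSemidef) {e : ℂ → ℂ} (c d : ℝ)
    (he : ∀ z, e z = (c : ℂ) * z + d) : MatStripBdd (fun z => matCpow A (e z)) := by
  simp only [he, _root_.matCpow, specFun, dif_pos hA.1]
  refine ((MatStripBdd.const _).mul fun i j => ?_).mul (MatStripBdd.const _)
  by_cases hij : i = j
  · subst hij
    simp only [Matrix.diagonal_apply_eq]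
    split_ifs with h
    · exact StripBdd.const 0
    · exact StripBdd.cpow (lt_of_le_of_ne (hA.eigenvalues_nonneg i) (Ne.symm h)) c d
  · simp only [Matrix.diagonal_apply_ne _ hij]
    exact StripBdd.const 0

end ThreeLines

lemma le_of_le_rpow_mul_rpow {x y t : ℝ} (hx : 0 ≤ x) (hy : 0 ≤ y) (ht : t < 1)
    (h : x ≤ y ^ (1 - t) * x ^ t) : x ≤ y := by
  rcases hx.eq_or_lt with rfl | hx
  · exact hy
  have h1 : x ^ (1 - t) * x ^ t = x := by rw [← Real.rpow_add hx]; simp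
  rw [← Real.rpow_le_rpow_iff hx.le hy (sub_pos.2 ht)]
  exact le_of_mul_le_mul_right (h1.le.trans h) (Real.rpow_pos_of_pos hx t)

section DataProcessing

variable {ι κ J : Type} [Fintype ι] [DecidableEq ι] [Fintype κ] [DecidableEq κ] [Fintype J]

/-- The operator `B^{(1-α)/(2α)} A B^{(1-α)/(2α)}` whose `α`-th power defines `D̃_α`. -/
def sandOp (α : ℝ) (A B : Matrix ι ι ℂ) : Matrix ι ι ℂ :=
  matCpow B (((1 - α) / (2 * α) : ℝ) : ℂ) * A * matCpow B (((1 - α) / (2 * α) : ℝ) : ℂ)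

/-- The sandwiched quasi-divergence `Tr (B^{(1-α)/(2α)} A B^{(1-α)/(2α)})^α`. -/
def sandQ (α : ℝ) (A B : Matrix ι ι ℂ) : ℝ := (matCpow (sandOp α A B) (α : ℂ)).trace.re

lemma sandOp_posSemidef (α : ℝ) {A B : Matrix ι ι ℂ} (hA : A.PosSemidef) (hB : B.PosSemidef) :
    (sandOp α A B).PosSemidef := by
  have := hA.mul_mul_conjTranspose_same (matCpow B (((1 - α) / (2 * α) : ℝ) : ℂ))
  rwa [matCpow_ofReal_conjTranspose hB] at this

lemma sandQ_nonneg (α : ℝ) {A B : Matrix ι ι ℂ} (hA : A.PosSemidef) (hB : B.PosSemidef) :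
    0 ≤ sandQ α A B :=
  (Complex.nonneg_iff.mp (matCpow_posSemidef (sandOp_posSemidef α hA hB) α).trace_nonneg).1

lemma sandQ_eq_trace (α : ℝ) {A B : Matrix ι ι ℂ} (hA : A.PosSemidef) (hB : B.PosSemidef) :
    (matCpow (sandOp α A B) (α : ℂ)).trace = (sandQ α A B : ℂ) :=
  posSemidef_trace_eq_re (matCpow_posSemidef (sandOp_posSemidef α hA hB) α)

/-- `Π_B A = A` for a Hermitian `A` supported in `B`, on both sides. -/
lemma mul_matCpow_zero_of {A B : Matrix ι ι ℂ} (hA : A.PosSemidef) (hB : B.PosSemidef)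
    (h : matCpow B 0 * A = A) : A * matCpow B 0 = A := by
  have := congrArg Matrix.conjTranspose h
  rwa [Matrix.conjTranspose_mul, matCpow_zero_conjTranspose hB, hA.1.eq] at this

/-- Data processing for the sandwiched quasi-divergence with `α > 1`. -/
theorem sandQ_krausMap_le {α : ℝ} (hα : 1 < α) {K : J → Matrix κ ι ℂ}
    (hK : ∑ j, (K j)ᴴ * K j = 1) {A B : Matrix ι ι ℂ} (hA : A.PosSemidef) (hB : B.PosSemidef)
    (hAB : matCpow B 0 * A = A) :
    sandQ α (krausMap K A) (krausMap K B) ≤ sandQ α A B := by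
  have hA' := krausMap_posSemidef K hA
  have hB' := krausMap_posSemidef K hB
  have hY := sandOp_posSemidef α hA hB
  have hY' := sandOp_posSemidef α hA' hB'
  have hα0 : α ≠ 0 := by linarith
  have hQ' := sandQ_eq_trace α hA' hB'
  have hQ0 := sandQ_nonneg α hA hB
  have hQ0' := sandQ_nonneg α hA' hB'
  set θ : ℝ := (α - 1) / α with hθ
  have hθ0 : 0 ≤ θ := div_nonneg (by linarith) (by linarith)
  have hθ1 : θ < 1 := by rw [hθ, div_lt_one (by linarith)]; linarith
  have hs : (1 - α) / (2 * α) = -θ / 2 := by rw [hθ]; field_simp; ring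
  have hsα : α * θ = α - 1 := by rw [hθ]; field_simp
  have hYdef : sandOp α A B = matCpow B (-θ / 2 : ℂ) * (A * matCpow B (-θ / 2 : ℂ)) := by
    rw [sandOp, hs, Matrix.mul_assoc]; push_cast; rfl
  have hYdef' : sandOp α (krausMap K A) (krausMap K B) = matCpow (krausMap K B) (-θ / 2 : ℂ) *
      (krausMap K A * matCpow (krausMap K B) (-θ / 2 : ℂ)) := by
    rw [sandOp, hs, Matrix.mul_assoc]; push_cast; rfl
  have hQdef : sandQ α A B = (matCpow (sandOp α A B) (α : ℂ)).trace.re := rfl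
  have hQdef' : sandQ α (krausMap K A) (krausMap K B) =
    (matCpow (sandOp α (krausMap K A) (krausMap K B)) (α : ℂ)).trace.re := rfl
  set Q := sandQ α A B
  set Q' := sandQ α (krausMap K A) (krausMap K B)
  set Y := sandOp α A B
  set Y' := sandOp α (krausMap K A) (krausMap K B)
  set B' := krausMap K B with hB'def
  let f : ℂ → ℂ := fun z => ∑ j, (matCpow Y' (α * z) * matCpow B' (-z / 2) * K j *
    matCpow B (z / 2) * matCpow Y (α * (1 - z)) * matCpow B (z / 2) * (K j)ᴴ *
    matCpow B' (-z / 2)).trace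
  have hf : StripBdd f := by
    refine StripBdd.sum fun j => MatStripBdd.trace ?_
    have e1 : MatStripBdd fun z => matCpow B' (-z / 2) :=
      MatStripBdd.matCpow hB' (-1 / 2) 0 fun z => by push_cast; ring
    have e2 : MatStripBdd fun z => matCpow B (z / 2) :=
      MatStripBdd.matCpow hB (1 / 2) 0 fun z => by push_cast; ring
    have e3 : MatStripBdd fun z => matCpow Y' (α * z) :=
      MatStripBdd.matCpow hY' α 0 fun z => by push_cast; ring
    have e4 : MatStripBdd fun z => matCpow Y (α * (1 - z)) :=
      MatStripBdd.matCpow hY (-α) α fun z => by push_cast; ring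
    exact ((((((e3.mul e1).mul (.const _)).mul e2).mul e4).mul e2).mul (.const _)).mul e1
  have hfθ : f θ = Q' := by
    have hBA : matCpow B (θ / 2) * (Y * matCpow B (θ / 2)) = A := by
      rw [hYdef]
      simp only [Matrix.mul_assoc]
      rw [matCpow_mul_mul, matCpow_mul]
      have : (-(θ : ℂ) / 2 + θ / 2) = 0 := by ring
      have h2 : ((θ : ℂ) / 2 + -θ / 2) = 0 := by ring
      rw [this, h2, mul_matCpow_zero_of hA hB hAB, hAB]
    have h1 : ((α : ℂ) * (1 - θ)) = 1 := by
      have : α * (1 - θ) = 1 := by linarith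
      exact_mod_cast this
    have h2 : ((α : ℂ) * θ) + 1 = α := by
      have : α * θ + 1 = α := by linarith
      exact_mod_cast this
    have : ∀ j, matCpow Y' (α * θ) * matCpow B' (-θ / 2) * K j * matCpow B (θ / 2) *
        matCpow Y (α * (1 - θ)) * matCpow B (θ / 2) * (K j)ᴴ * matCpow B' (-θ / 2) =
        matCpow Y' (α * θ) * matCpow B' (-θ / 2) * (K j * A * (K j)ᴴ) * matCpow B' (-θ / 2) := by
      intro j
      rw [h1, matCpow_one hY]
      conv_rhs => rw [← hBA]
      simp only [Matrix.mul_assoc]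
    simp only [f, this]
    rw [← Matrix.trace_sum, ← Matrix.sum_mul, ← Matrix.mul_sum, ← krausMap, ← hQ']
    simp only [Matrix.mul_assoc]
    rw [← hYdef']
    conv_lhs => enter [1, 2]; rw [← matCpow_one hY']
    rw [matCpow_mul, h2]
  have h0 : ∀ z : ℂ, z.re = 0 → ‖f z‖ ≤ Q := by
    intro z hz
    have hmain := norm_sum_trace_mul_le (a := Q) (b := Q)
      (fun j => matCpow Y' (α * z) * (matCpow B' (-z / 2) * (K j *
        (matCpow B (z / 2) * matCpow Y (α * (1 - z) - α / 2)))))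
      (fun j => matCpow Y (α / 2) * (matCpow B (z / 2) * ((K j)ᴴ * matCpow B' (-z / 2)))) ?_ ?_
    · rw [Real.mul_self_sqrt hQ0] at hmain
      convert hmain using 5 with j
      simp only [Matrix.mul_assoc]
      rw [matCpow_mul_mul, sub_add_cancel]
    · calc _ ≤ ∑ j, frobSq (K j * (matCpow B (z / 2) * matCpow Y (α * (1 - z) - α / 2))) :=
            Finset.sum_le_sum fun j _ =>
              (frobSq_matCpow_mul_le hY' (by simp [hz]) _).trans
                (frobSq_matCpow_mul_le hB' (by simp [hz]) _)
        _ = frobSq (matCpow B (z / 2) * matCpow Y (α * (1 - z) - α / 2)) :=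
            sum_frobSq_kraus_mul hK _
        _ ≤ frobSq (matCpow Y (α * (1 - z) - α / 2)) := frobSq_matCpow_mul_le hB (by simp [hz]) _
        _ = Q := by
            rw [frobSq_matCpow hY, hQdef]
            congr 5
            simp [hz]; ring
    · calc _ = ∑ j, frobSq (matCpow B' (star (-z / 2)) * (K j *
              (matCpow B (star (z / 2)) * matCpow Y (α / 2)))) :=
            Finset.sum_congr rfl fun j _ => by
              rw [← frobSq_conjTranspose]
              simp only [Matrix.conjTranspose_mul, matCpow_conjTranspose hY,
                matCpow_conjTranspose hB, matCpow_conjTranspose hB',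
                Matrix.conjTranspose_conjTranspose, Matrix.mul_assoc]
              congr 5
              simp
        _ ≤ ∑ j, frobSq (K j * (matCpow B (star (z / 2)) * matCpow Y (α / 2))) :=
            Finset.sum_le_sum fun j _ => frobSq_matCpow_mul_le hB' (by simp [hz]) _
        _ = frobSq (matCpow B (star (z / 2)) * matCpow Y (α / 2)) := sum_frobSq_kraus_mul hK _
        _ ≤ frobSq (matCpow Y (α / 2)) := frobSq_matCpow_mul_le hB (by simp [hz]) _
        _ = Q := by
            rw [frobSq_matCpow hY, hQdef]
            congr 5
            simp; ring
  have h1 : ∀ z : ℂ, z.re = 1 → ‖f z‖ ≤ Q' := by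
    intro z hz
    have hmain := norm_sum_trace_mul_le (a := Q') (b := Q')
      (fun j => matCpow Y' (α * z - α / 2) * (matCpow B' (-z / 2) * (K j *
        (matCpow B (z / 2) * matCpow Y (α * (1 - z))))))
      (fun j => matCpow B (z / 2) * (K j)ᴴ * matCpow B' (-z / 2) * matCpow Y' (α / 2)) ?_ ?_
    · rw [Real.mul_self_sqrt hQ0'] at hmain
      convert hmain using 3 with j
      conv_rhs => rw [← Matrix.mul_assoc, Matrix.trace_mul_comm]
      simp only [Matrix.mul_assoc]
      rw [matCpow_mul_mul, add_sub_cancel]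
    · calc _ = ∑ j, frobSq (matCpow Y (star (α * (1 - z))) * (matCpow B (star (z / 2)) * (K j)ᴴ *
              matCpow B' (star (-z / 2)) * matCpow Y' (star (α * z - α / 2)))) :=
            Finset.sum_congr rfl fun j _ => by
              rw [← frobSq_conjTranspose]
              simp only [Matrix.conjTranspose_mul, matCpow_conjTranspose hY,
                matCpow_conjTranspose hB, matCpow_conjTranspose hB', matCpow_conjTranspose hY',
                Matrix.mul_assoc]
        _ ≤ ∑ j, frobSq (matCpow B (star (z / 2)) * (K j)ᴴ *
              matCpow B' (star (-z / 2)) * matCpow Y' (star (α * z - α / 2))) :=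
            Finset.sum_le_sum fun j _ => frobSq_matCpow_mul_le hY (by simp [hz]) _
        _ ≤ frobSq (matCpow Y' (star (α * z - α / 2))) :=
            sum_frobSq_petz_le K hB (by simp [hz]) (by rw [← star_neg, neg_div]) _
        _ = Q' := by
            rw [frobSq_matCpow hY', hQdef']
            congr 5
            simp [hz]; ring
    · refine (sum_frobSq_petz_le K hB (by simp [hz]) (by rw [neg_div]) _).trans (le_of_eq ?_)
      rw [frobSq_matCpow hY', hQdef']
      congr 5
      simp; ring
  have := hf.norm_le hθ0 hθ1.le h0 h1
  rw [hfθ, Complex.norm_real, Real.norm_of_nonneg hQ0'] at this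
  exact le_of_le_rpow_mul_rpow hQ0' hQ0 hθ1 this

/-- Data processing for the sandwiched quasi-divergence with `1/2 ≤ α < 1`. -/
theorem le_sandQ_krausMap {α : ℝ} (hα : 1 / 2 ≤ α) (hα1 : α < 1) {K : J → Matrix κ ι ℂ}
    (hK : ∑ j, (K j)ᴴ * K j = 1) {A B : Matrix ι ι ℂ} (hA : A.PosSemidef) (hB : B.PosSemidef) :
    sandQ α A B ≤ sandQ α (krausMap K A) (krausMap K B) := by
  have hA' := krausMap_posSemidef K hA
  have hB' := krausMap_posSemidef K hB
  have hY := sandOp_posSemidef α hA hB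
  have hY' := sandOp_posSemidef α hA' hB'
  have hα0 : α ≠ 0 := by linarith
  have hQ := sandQ_eq_trace α hA hB
  have hQ0 := sandQ_nonneg α hA hB
  have hQ0' := sandQ_nonneg α hA' hB'
  set θ : ℝ := (1 - α) / α with hθ
  have hθ0 : 0 < θ := div_pos (by linarith) (by linarith)
  have hθ1 : θ ≤ 1 := by rw [hθ, div_le_one (by linarith)]; linarith
  have hs : (1 - α) / (2 * α) = θ / 2 := by rw [hθ]; field_simp
  have hsα : α * θ = 1 - α := by rw [hθ]; field_simp
  have hBs : (matCpow B (θ / 2 : ℂ))ᴴ = matCpow B (θ / 2 : ℂ) := by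
    have := matCpow_ofReal_conjTranspose hB (θ / 2)
    push_cast at this; exact this
  have hBs' : (matCpow (krausMap K B) (θ / 2 : ℂ))ᴴ = matCpow (krausMap K B) (θ / 2 : ℂ) := by
    have := matCpow_ofReal_conjTranspose hB' (θ / 2)
    push_cast at this; exact this
  have hYdef : sandOp α A B = matCpow B (θ / 2 : ℂ) * (A * matCpow B (θ / 2 : ℂ)) := by
    rw [sandOp, hs, Matrix.mul_assoc]; push_cast; rfl
  have hYdef' : sandOp α (krausMap K A) (krausMap K B) = matCpow (krausMap K B) (θ / 2 : ℂ) *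
      (krausMap K A * matCpow (krausMap K B) (θ / 2 : ℂ)) := by
    rw [sandOp, hs, Matrix.mul_assoc]; push_cast; rfl
  have hQdef : sandQ α A B = (matCpow (sandOp α A B) (α : ℂ)).trace.re := rfl
  have hQdef' : sandQ α (krausMap K A) (krausMap K B) =
    (matCpow (sandOp α (krausMap K A) (krausMap K B)) (α : ℂ)).trace.re := rfl
  set Q := sandQ α A B
  set Q' := sandQ α (krausMap K A) (krausMap K B)
  set Y := sandOp α A B
  set Y' := sandOp α (krausMap K A) (krausMap K B)
  have hsum := sum_kraus_half_gram K hA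
  set B' := krausMap K B with hB'def
  set X : Matrix ι ι ℂ := matCpow B (θ / 2) * matCpow A (1 / 2) with hXdef
  let G : J → Matrix κ ι ℂ := fun j => matCpow B' (θ / 2) * (K j * matCpow A (1 / 2))
  have hX : X * Xᴴ = Y := by
    rw [hYdef, hXdef, Matrix.conjTranspose_mul, hBs]
    conv_rhs => rw [← matCpow_half_gram hA]
    simp only [Matrix.mul_assoc]
  have hG : ∑ j, G j * (G j)ᴴ = Y' := by
    rw [hYdef', ← hsum, Finset.sum_mul, Finset.mul_sum]
    refine Finset.sum_congr rfl fun j _ => ?_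
    simp only [G]
    rw [Matrix.conjTranspose_mul (matCpow B' _), hBs']
    simp only [Matrix.mul_assoc]
  let f : ℂ → ℂ := fun z => ∑ j, (Xᴴ * matCpow Y (-1 / 2 + α * (1 - z) / 2) * matCpow B (z / 2) *
    (K j)ᴴ * matCpow B' (-z / 2) * matCpow Y' ((α - 1) / 2 + α * z / 2) * G j).trace
  have hf : StripBdd f := by
    refine StripBdd.sum fun j => MatStripBdd.trace ?_
    have e1 : MatStripBdd fun z => matCpow B' (-z / 2) :=
      MatStripBdd.matCpow hB' (-1 / 2) 0 fun z => by push_cast; ring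
    have e2 : MatStripBdd fun z => matCpow B (z / 2) :=
      MatStripBdd.matCpow hB (1 / 2) 0 fun z => by push_cast; ring
    have e3 : MatStripBdd fun z => matCpow Y' ((α - 1) / 2 + α * z / 2) :=
      MatStripBdd.matCpow hY' (α / 2) ((α - 1) / 2) fun z => by push_cast; ring
    have e4 : MatStripBdd fun z => matCpow Y (-1 / 2 + α * (1 - z) / 2) :=
      MatStripBdd.matCpow hY (-α / 2) (-1 / 2 + α / 2) fun z => by push_cast; ring
    exact ((((((MatStripBdd.const _).mul e4).mul e2).mul (.const _)).mul e1).mul e3).mul (.const _)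
  have hfθ : f θ = Q := by
    have hsα' : (α : ℂ) * θ = 1 - α := by exact_mod_cast hsα
    have h1 : (-1 / 2 + (α : ℂ) * (1 - θ) / 2) = α - 1 := by linear_combination -(1 / 2) * hsα'
    have h2 : ((α : ℂ) - 1) / 2 + α * θ / 2 = 0 := by linear_combination (1 / 2) * hsα'
    have : ∀ j, Xᴴ * matCpow Y (-1 / 2 + α * (1 - θ) / 2) * matCpow B (θ / 2) *
        (K j)ᴴ * matCpow B' (-θ / 2) * matCpow Y' ((α - 1) / 2 + α * θ / 2) * G j =
        Xᴴ * matCpow Y (α - 1) * matCpow B (θ / 2) * ((K j)ᴴ * K j) * matCpow A (1 / 2) := by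
      intro j
      have h3 := mul_matCpow_krausMap_zero K hB (θ / 2) j
      rw [h1, h2, Matrix.mul_assoc _ (matCpow Y' 0), matCpow_zero_mul_of_sum hY' hG]
      simp only [G, Matrix.mul_assoc]
      rw [matCpow_mul_mul, neg_div, neg_add_cancel, ← hB'def] at *
      rw [← Matrix.mul_assoc (K j)ᴴ (matCpow B' 0), ← Matrix.mul_assoc (matCpow B _),
        ← Matrix.mul_assoc (matCpow B _) (K j)ᴴ, h3]
      simp only [Matrix.mul_assoc]
    simp only [f, this]
    rw [← Matrix.trace_sum, ← Matrix.sum_mul, ← Matrix.mul_sum, hK, Matrix.mul_one,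
      Matrix.mul_assoc, ← hXdef, Matrix.trace_mul_comm, ← Matrix.mul_assoc, hX, ← hQ]
    conv_lhs => enter [1, 1]; rw [← matCpow_one hY]
    rw [matCpow_mul, add_sub_cancel]
  have hX0 : ∀ z : ℂ, 2 * z.re + 1 = α → frobSq (matCpow Y z * X) = Q := by
    intro z hz
    have := sum_frobSq_matCpow_mul (J := Unit) hY (G := fun _ => X) (by simpa using hX) z
    rw [hz] at this
    simpa [hQdef] using this
  have hG0 : ∀ z : ℂ, 2 * z.re + 1 = α → ∑ j, frobSq (matCpow Y' z * G j) = Q' := by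
    intro z hz
    rw [sum_frobSq_matCpow_mul hY' hG z, hz, hQdef']
  have h0 : ∀ z : ℂ, z.re = 0 → ‖f z‖ ≤ √Q * √Q' := by
    intro z hz
    have hmain := norm_sum_trace_mul_le (a := Q) (b := Q')
      (fun j => Xᴴ * matCpow Y (-1 / 2 + α * (1 - z) / 2) * matCpow B (z / 2) *
        (K j)ᴴ * matCpow B' (-z / 2))
      (fun j => matCpow Y' ((α - 1) / 2 + α * z / 2) * G j) ?_ (hG0 _ (by simp [hz]; ring)).le
    · convert hmain using 4 with j
      simp only [Matrix.mul_assoc]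
    · calc _ = ∑ j, frobSq (matCpow B' (star (-z / 2)) * (K j * (matCpow B (star (z / 2)) *
              (matCpow Y (star (-1 / 2 + α * (1 - z) / 2)) * X)))) :=
            Finset.sum_congr rfl fun j _ => by
              rw [← frobSq_conjTranspose]
              simp only [Matrix.conjTranspose_mul, matCpow_conjTranspose hY,
                matCpow_conjTranspose hB, matCpow_conjTranspose hB',
                Matrix.conjTranspose_conjTranspose]
        _ ≤ ∑ j, frobSq (K j * (matCpow B (star (z / 2)) *
              (matCpow Y (star (-1 / 2 + α * (1 - z) / 2)) * X))) :=
            Finset.sum_le_sum fun j _ => frobSq_matCpow_mul_le hB' (by simp [hz]) _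
        _ = frobSq (matCpow B (star (z / 2)) *
              (matCpow Y (star (-1 / 2 + α * (1 - z) / 2)) * X)) := sum_frobSq_kraus_mul hK _
        _ ≤ frobSq (matCpow Y (star (-1 / 2 + α * (1 - z) / 2)) * X) :=
            frobSq_matCpow_mul_le hB (by simp [hz]) _
        _ = Q := hX0 _ (by simp [hz]; ring)
  have h1 : ∀ z : ℂ, z.re = 1 → ‖f z‖ ≤ Q' := by
    intro z hz
    have hmain := norm_sum_trace_mul_le (a := Q') (b := Q')
      (fun j => (Xᴴ * matCpow Y (-1 / 2 + α * (1 - z) / 2)) * (matCpow B (z / 2) *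
        (K j)ᴴ * matCpow B' (-z / 2) * matCpow Y' (α / 2)))
      (fun j => matCpow Y' ((α - 1) / 2 + α * z / 2 - α / 2) * G j) ?_
      (hG0 _ (by simp [hz]; ring)).le
    · rw [Real.mul_self_sqrt hQ0'] at hmain
      convert hmain using 4 with j
      simp only [Matrix.mul_assoc]
      rw [matCpow_mul_mul, add_sub_cancel]
    · have hC : (Xᴴ * matCpow Y (-1 / 2 + α * (1 - z) / 2))ᴴ *
          (Xᴴ * matCpow Y (-1 / 2 + α * (1 - z) / 2)) = matCpow Y 0 := by
        rw [Matrix.conjTranspose_mul, Matrix.conjTranspose_conjTranspose, Matrix.mul_assoc,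
          ← Matrix.mul_assoc X, hX, matCpow_conjTranspose hY]
        conv_lhs => enter [2, 1]; rw [← matCpow_one hY]
        rw [matCpow_mul, matCpow_mul]
        congr 1
        have hw : ∀ w : ℂ, w.re = -1 / 2 → star w + (1 + w) = 0 := fun w hw => by
          have := Complex.add_conj w
          rw [hw] at this
          rw [Complex.star_def]
          push_cast at this
          linear_combination this
        exact hw _ (by simp [hz])
      refine (Finset.sum_le_sum fun j _ => frobSq_mul_le_of_gram_eq hY hC _).trans ?_
      refine (sum_frobSq_petz_le K hB (by simp [hz]) (by rw [neg_div]) _).trans (le_of_eq ?_)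
      rw [frobSq_matCpow hY', hQdef']
      congr 5
      simp; ring
  have := hf.norm_le hθ0.le hθ1 h0 h1
  rw [hfθ, Complex.norm_real, Real.norm_of_nonneg hQ0] at this
  refine le_of_le_rpow_mul_rpow (t := (1 - θ) / 2) hQ0 hQ0' (by linarith) (this.trans (le_of_eq ?_))
  rw [Real.sqrt_eq_rpow, Real.sqrt_eq_rpow, Real.mul_rpow (by positivity) (by positivity),
    ← Real.rpow_mul hQ0, ← Real.rpow_mul hQ0', mul_assoc,
    ← Real.rpow_add_of_nonneg hQ0' (by linarith) hθ0.le, mul_comm]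
  congr 2 <;> ring

/-- The Petz quasi-divergence `Tr A^a B^{1-a}`. -/
def petzQ (a : ℝ) (A B : Matrix ι ι ℂ) : ℝ :=
  (matCpow A (a : ℂ) * matCpow B ((1 - a : ℝ) : ℂ)).trace.re

lemma petzQ_eq_frobSq (a : ℝ) {A B : Matrix ι ι ℂ} (hA : A.PosSemidef) (hB : B.PosSemidef) :
    petzQ a A B =
      frobSq (matCpow A ((a / 2 : ℝ) : ℂ) * matCpow B (((1 - a) / 2 : ℝ) : ℂ)) := by
  rw [frobSq, Matrix.conjTranspose_mul, matCpow_ofReal_conjTranspose hA,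
    matCpow_ofReal_conjTranspose hB, Matrix.mul_assoc, matCpow_mul_mul, Matrix.trace_mul_comm,
    Matrix.mul_assoc, matCpow_mul, petzQ]
  congr 5 <;> push_cast <;> ring

lemma petzQ_nonneg (a : ℝ) {A B : Matrix ι ι ℂ} (hA : A.PosSemidef) (hB : B.PosSemidef) :
    0 ≤ petzQ a A B := by
  rw [petzQ_eq_frobSq a hA hB]; exact frobSq_nonneg _

/-- Data processing for the Petz quasi-divergence with `0 ≤ a ≤ 1`. -/
theorem petzQ_le_krausMap {a : ℝ} (ha0 : 0 ≤ a) (ha1 : a ≤ 1) {K : J → Matrix κ ι ℂ}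
    (hK : ∑ j, (K j)ᴴ * K j = 1) {A B : Matrix ι ι ℂ} (hA : A.PosSemidef) (hB : B.PosSemidef) :
    petzQ a A B ≤ petzQ a (krausMap K A) (krausMap K B) := by
  have hA' := krausMap_posSemidef K hA
  have hB' := krausMap_posSemidef K hB
  rw [petzQ_eq_frobSq a hA hB, petzQ_eq_frobSq a hA' hB']
  set A' := krausMap K A with hA'def
  set B' := krausMap K B with hB'def
  set X := matCpow A ((a / 2 : ℝ) : ℂ) * matCpow B (((1 - a) / 2 : ℝ) : ℂ) with hX
  set X' := matCpow A' ((a / 2 : ℝ) : ℂ) * matCpow B' (((1 - a) / 2 : ℝ) : ℂ) with hX'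
  let f : ℂ → ℂ := fun z => ∑ j, (Xᴴ * matCpow A ((1 - z) / 2) * (K j)ᴴ *
    matCpow A' (-((1 - z) / 2)) * X' * matCpow B' (-(z / 2)) * K j * matCpow B (z / 2)).trace
  have hf : StripBdd f := by
    refine StripBdd.sum fun j => MatStripBdd.trace ?_
    have e1 : MatStripBdd fun z => matCpow B' (-(z / 2)) :=
      MatStripBdd.matCpow hB' (-1 / 2) 0 fun z => by push_cast; ring
    have e2 : MatStripBdd fun z => matCpow B (z / 2) :=
      MatStripBdd.matCpow hB (1 / 2) 0 fun z => by push_cast; ring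
    have e3 : MatStripBdd fun z => matCpow A ((1 - z) / 2) :=
      MatStripBdd.matCpow hA (-1 / 2) (1 / 2) fun z => by push_cast; ring
    have e4 : MatStripBdd fun z => matCpow A' (-((1 - z) / 2)) :=
      MatStripBdd.matCpow hA' (1 / 2) (-1 / 2) fun z => by push_cast; ring
    exact (((((((MatStripBdd.const _).mul e3).mul (.const _)).mul e4).mul (.const _)).mul e1).mul
      (.const _)).mul e2
  have hfa : f ((1 - a : ℝ) : ℂ) = (frobSq X : ℂ) := by
    have e1 : (1 - ((1 - a : ℝ) : ℂ)) / 2 = ((a / 2 : ℝ) : ℂ) := by push_cast; ring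
    have e2 : ((1 - a : ℝ) : ℂ) / 2 = (((1 - a) / 2 : ℝ) : ℂ) := by push_cast; ring
    have : ∀ j, Xᴴ * matCpow A ((a / 2 : ℝ) : ℂ) * (K j)ᴴ * matCpow A' (-((a / 2 : ℝ) : ℂ)) * X' *
        matCpow B' (-(((1 - a) / 2 : ℝ) : ℂ)) * K j * matCpow B (((1 - a) / 2 : ℝ) : ℂ) =
        Xᴴ * matCpow A ((a / 2 : ℝ) : ℂ) * ((K j)ᴴ * K j) * matCpow B (((1 - a) / 2 : ℝ) : ℂ) := by
      intro j
      have h1 := mul_matCpow_krausMap_zero K hA ((a / 2 : ℝ) : ℂ) j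
      have h2 := matCpow_krausMap_zero_mul K hB (((1 - a) / 2 : ℝ) : ℂ) j
      rw [← hA'def] at h1
      rw [← hB'def] at h2
      rw [hX']
      simp only [Matrix.mul_assoc]
      rw [matCpow_mul_mul, matCpow_mul_mul, neg_add_cancel, add_neg_cancel, h2,
        ← Matrix.mul_assoc (K j)ᴴ (matCpow A' 0), ← Matrix.mul_assoc (matCpow A _),
        ← Matrix.mul_assoc (matCpow A _) (K j)ᴴ, h1]
      simp only [Matrix.mul_assoc]
    simp only [f, e1, e2, this]
    rw [← Matrix.trace_sum, ← Matrix.sum_mul, ← Matrix.mul_sum, hK, Matrix.mul_one,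
      Matrix.mul_assoc, ← hX, frobSq, ← posSemidef_trace_eq_re]
    exact Matrix.posSemidef_conjTranspose_mul_self X
  have h0 : ∀ z : ℂ, z.re = 0 → ‖f z‖ ≤ √(frobSq X') * √(frobSq X) := by
    intro z hz
    have hmain := norm_sum_trace_mul_le (a := frobSq X') (b := frobSq X)
      (fun j => matCpow A ((1 - z) / 2) * (K j)ᴴ * matCpow A' (-((1 - z) / 2)) * X')
      (fun j => matCpow B' (-(z / 2)) * (K j * (matCpow B (z / 2) * Xᴴ))) ?_ ?_
    · convert hmain using 3 with j
      simp only [Matrix.mul_assoc]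
      rw [Matrix.trace_mul_comm Xᴴ]
      simp only [Matrix.mul_assoc]
    · exact sum_frobSq_petz_le K hA (by simp [hz]) rfl _
    · calc _ ≤ ∑ j, frobSq (K j * (matCpow B (z / 2) * Xᴴ)) :=
            Finset.sum_le_sum fun j _ => frobSq_matCpow_mul_le hB' (by simp [hz]) _
        _ = frobSq (matCpow B (z / 2) * Xᴴ) := sum_frobSq_kraus_mul hK _
        _ ≤ frobSq Xᴴ := frobSq_matCpow_mul_le hB (by simp [hz]) _
        _ = frobSq X := frobSq_conjTranspose X
  have h1 : ∀ z : ℂ, z.re = 1 → ‖f z‖ ≤ √(frobSq X') * √(frobSq X) := by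
    intro z hz
    have hmain := norm_sum_trace_mul_le (a := frobSq X) (b := frobSq X')
      (fun j => Xᴴ * matCpow A ((1 - z) / 2) * (K j)ᴴ * matCpow A' (-((1 - z) / 2)))
      (fun j => X' * matCpow B' (-(z / 2)) * K j * matCpow B (z / 2)) ?_ ?_
    · rw [mul_comm]
      convert hmain using 4 with j
      simp only [Matrix.mul_assoc]
    · calc _ = ∑ j, frobSq (matCpow A' (star (-((1 - z) / 2))) * (K j *
              (matCpow A (star ((1 - z) / 2)) * X))) :=
            Finset.sum_congr rfl fun j _ => by
              rw [← frobSq_conjTranspose]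
              simp only [Matrix.conjTranspose_mul, matCpow_conjTranspose hA,
                matCpow_conjTranspose hA', Matrix.conjTranspose_conjTranspose]
        _ ≤ ∑ j, frobSq (K j * (matCpow A (star ((1 - z) / 2)) * X)) :=
            Finset.sum_le_sum fun j _ => frobSq_matCpow_mul_le hA' (by simp [hz]) _
        _ = frobSq (matCpow A (star ((1 - z) / 2)) * X) := sum_frobSq_kraus_mul hK _
        _ ≤ frobSq X := frobSq_matCpow_mul_le hA (by simp [hz]) _
    · calc _ = ∑ j, frobSq (matCpow B (star (z / 2)) * (K j)ᴴ * matCpow B' (star (-(z / 2))) *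
              X'ᴴ) :=
            Finset.sum_congr rfl fun j _ => by
              rw [← frobSq_conjTranspose]
              simp only [Matrix.conjTranspose_mul, matCpow_conjTranspose hB,
                matCpow_conjTranspose hB', Matrix.mul_assoc]
        _ ≤ frobSq X'ᴴ := sum_frobSq_petz_le K hB (by simp [hz]) (star_neg _) _
        _ = frobSq X' := frobSq_conjTranspose X'
  have := hf.norm_le (t := 1 - a) (by linarith) (by linarith) h0 h1
  rw [hfa, Complex.norm_real, Real.norm_of_nonneg (frobSq_nonneg X),
    ← Real.rpow_add_of_nonneg (by positivity) (by linarith) (by linarith)] at this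
  refine le_of_le_rpow_mul_rpow (t := 1 / 2) (frobSq_nonneg X) (frobSq_nonneg X') (by norm_num) ?_
  rw [sub_add_cancel, Real.rpow_one] at this
  rw [← Real.sqrt_eq_rpow]
  norm_num
  rwa [← Real.sqrt_eq_rpow]

end DataProcessing

section Support

variable {ι κ J : Type} [Fintype ι] [DecidableEq ι] [Fintype κ] [DecidableEq κ] [Fintype J]

lemma suppLE_iff {A B : Matrix ι ι ℂ} (hA : A.PosSemidef) (hB : B.PosSemidef) :
    suppLE A B ↔ matCpow B 0 * A = A := by
  constructor
  · intro h
    have h1 : A * (1 - matCpow B 0) = 0 := by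
      refine Matrix.ext_of_mulVec_single fun i => ?_
      rw [← Matrix.mulVec_mulVec, Matrix.zero_mulVec]
      apply h
      rw [Matrix.mulVec_mulVec]
      conv_lhs => enter [1, 1]; rw [← matCpow_one hB]
      rw [Matrix.mul_sub, Matrix.mul_one, matCpow_mul, add_zero, sub_self, Matrix.zero_mulVec]
    rw [Matrix.mul_sub, Matrix.mul_one, sub_eq_zero] at h1
    have h2 := congrArg Matrix.conjTranspose h1
    rw [Matrix.conjTranspose_mul, matCpow_zero_conjTranspose hB, hA.1.eq] at h2
    exact h2.symm
  · intro h v hv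
    rw [← mul_matCpow_zero_of hA hB h, ← Matrix.mulVec_mulVec]
    have : matCpow B 0 = matCpow B (-1) * B := by
      conv_rhs => enter [2]; rw [← matCpow_one hB]
      rw [matCpow_mul, neg_add_cancel]
    rw [this, ← Matrix.mulVec_mulVec, hv, Matrix.mulVec_zero, Matrix.mulVec_zero]

lemma suppLE.krausMap {A B : Matrix ι ι ℂ} (h : suppLE A B) (hA : A.PosSemidef)
    (hB : B.PosSemidef) (K : J → Matrix κ ι ℂ) : suppLE (krausMap K A) (krausMap K B) := by
  rw [suppLE_iff hA hB] at h
  rw [suppLE_iff (krausMap_posSemidef K hA) (krausMap_posSemidef K hB)]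
  conv_lhs => enter [2]; rw [_root_.krausMap]
  rw [Finset.mul_sum]
  refine Finset.sum_congr rfl fun j _ => ?_
  conv_lhs => rw [← h]
  conv_rhs => rw [← h]
  simp only [← Matrix.mul_assoc]
  rw [Matrix.mul_assoc _ (K j), matCpow_krausMap_zero_mul K hB]

lemma suppLE_blockDiagonal_iff {A B : κ → Matrix ι ι ℂ} (hA : ∀ x, (A x).PosSemidef)
    (hB : ∀ x, (B x).PosSemidef) :
    suppLE (Matrix.blockDiagonal A) (Matrix.blockDiagonal B) ↔ ∀ x, suppLE (A x) (B x) := by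
  rw [suppLE_iff (posSemidef_blockDiagonal hA) (posSemidef_blockDiagonal hB),
    matCpow_blockDiagonal hB, ← Matrix.blockDiagonal_mul, Matrix.blockDiagonal_inj, funext_iff]
  exact forall_congr' fun x => (suppLE_iff (hA x) (hB x)).symm

lemma suppLE.kronecker {A B : Matrix ι ι ℂ} {C D : Matrix κ κ ℂ} (hAB : suppLE A B)
    (hCD : suppLE C D) (hA : A.PosSemidef) (hB : B.PosSemidef) (hC : C.PosSemidef)
    (hD : D.PosSemidef) : suppLE (A ⊗ₖ C) (B ⊗ₖ D) := by
  rw [suppLE_iff hA hB] at hAB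
  rw [suppLE_iff hC hD] at hCD
  rw [suppLE_iff (hA.kronecker hC) (hB.kronecker hD), matCpow_kronecker hB hD,
    ← Matrix.mul_kronecker_mul, hAB, hCD]

lemma matCpow_half_mul_eq_zero_iff {A B : Matrix ι ι ℂ} (hA : A.PosSemidef) (hB : B.PosSemidef)
    (z : ℂ) : matCpow A (1 / 2) * matCpow B z = 0 ↔ A * B = 0 := by
  constructor
  · intro h
    have : A * B = matCpow A (1 / 2) * (matCpow A (1 / 2) * matCpow B z) * matCpow B (1 - z) := by
      rw [matCpow_mul_mul, Matrix.mul_assoc, matCpow_mul]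
      norm_num [matCpow_one hA, matCpow_one hB]
    rw [this, h, Matrix.mul_zero, Matrix.zero_mul]
  · intro h
    have : matCpow A (1 / 2) * matCpow B z = matCpow A (-1 / 2) * (A * B) * matCpow B (z - 1) := by
      conv_rhs => enter [1, 2]; rw [← matCpow_one hA, ← matCpow_one hB]
      rw [matCpow_mul_mul, Matrix.mul_assoc, matCpow_mul]
      norm_num
    rw [this, h, Matrix.mul_zero, Matrix.zero_mul]

lemma trace_mul_eq_zero_iff {A B : Matrix ι ι ℂ} (hA : A.PosSemidef) (hB : B.PosSemidef) :
    (A * B).trace = 0 ↔ A * B = 0 := by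
  rw [← matCpow_half_mul_eq_zero_iff hA hB (1 / 2),
    ← Matrix.trace_conjTranspose_mul_self_eq_zero_iff, Matrix.conjTranspose_mul]
  have ha := matCpow_half_gram hA
  have hb := matCpow_half_gram hB
  have hA' := matCpow_ofReal_conjTranspose hA (1 / 2)
  push_cast at hA'
  have : A * B = A * (matCpow B (1 / 2) * (matCpow B (1 / 2))ᴴ) := by rw [hb]
  rw [this, ← Matrix.mul_assoc, Matrix.trace_mul_comm, ← Matrix.mul_assoc, hA', Matrix.mul_assoc,
    Matrix.mul_assoc, matCpow_mul_mul, ← Matrix.mul_assoc]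
  norm_num [matCpow_one hA, Matrix.mul_assoc]

lemma posSemidef_eq_zero_of_matCpow {A : Matrix ι ι ℂ} (hA : A.PosSemidef) {z : ℂ}
    (h : matCpow A z = 0) : A = 0 := by
  rw [← matCpow_one hA, ← sub_add_cancel 1 z, ← matCpow_mul, h, Matrix.mul_zero]

lemma matCpow_zero_matrix (z : ℂ) : matCpow (0 : Matrix ι ι ℂ) z = 0 := by
  have h : matCpow (0 : Matrix ι ι ℂ) 1 = 0 := matCpow_one Matrix.PosSemidef.zero
  rw [← sub_add_cancel z 1, ← matCpow_mul, h, Matrix.mul_zero]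

lemma sandQ_eq_zero_iff (α : ℝ) {A B : Matrix ι ι ℂ} (hA : A.PosSemidef) (hB : B.PosSemidef) :
    sandQ α A B = 0 ↔ A * B = 0 := by
  have hY := sandOp_posSemidef α hA hB
  rw [← matCpow_half_mul_eq_zero_iff hA hB (((1 - α) / (2 * α) : ℝ) : ℂ),
    ← Matrix.conjTranspose_mul_self_eq_zero]
  have h1 : (matCpow A (1 / 2) * matCpow B (((1 - α) / (2 * α) : ℝ) : ℂ))ᴴ *
      (matCpow A (1 / 2) * matCpow B (((1 - α) / (2 * α) : ℝ) : ℂ)) = sandOp α A B := by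
    have hA' := matCpow_ofReal_conjTranspose hA (1 / 2)
    push_cast at hA'
    rw [Matrix.conjTranspose_mul, matCpow_ofReal_conjTranspose hB, hA', Matrix.mul_assoc,
      matCpow_mul_mul, ← Matrix.mul_assoc, sandOp]
    norm_num [matCpow_one hA]
  rw [h1]
  constructor
  · intro h
    have h2 := sandQ_eq_trace α hA hB
    rw [h, Complex.ofReal_zero, (matCpow_posSemidef hY α).trace_eq_zero_iff] at h2
    exact posSemidef_eq_zero_of_matCpow hY h2
  · intro h
    rw [sandQ, h, matCpow_zero_matrix]; simp

lemma eq_zero_of_suppLE {A B : Matrix ι ι ℂ} (hA : A.PosSemidef) (hB : B.PosSemidef)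
    (h : suppLE A B) (h0 : A * B = 0) : A = 0 := by
  rw [← mul_matCpow_zero_of hA hB ((suppLE_iff hA hB).1 h)]
  have : matCpow B 0 = B * matCpow B (-1) := by
    conv_rhs => enter [1]; rw [← matCpow_one hB]
    rw [matCpow_mul, add_neg_cancel]
  rw [this, ← Matrix.mul_assoc, h0, Matrix.zero_mul]

end Support

section Structure

variable {ι κ J : Type} [Fintype ι] [DecidableEq ι] [Fintype κ] [DecidableEq κ] [Fintype J]

lemma sandOp_blockDiagonal (α : ℝ) {A B : κ → Matrix ι ι ℂ} (hB : ∀ x, (B x).PosSemidef) :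
    sandOp α (Matrix.blockDiagonal A) (Matrix.blockDiagonal B) =
      Matrix.blockDiagonal (fun x => sandOp α (A x) (B x)) := by
  simp only [sandOp, matCpow_blockDiagonal hB, Matrix.blockDiagonal_mul]

lemma sandQ_blockDiagonal (α : ℝ) {A B : κ → Matrix ι ι ℂ} (hA : ∀ x, (A x).PosSemidef)
    (hB : ∀ x, (B x).PosSemidef) :
    sandQ α (Matrix.blockDiagonal A) (Matrix.blockDiagonal B) = ∑ x, sandQ α (A x) (B x) := by
  rw [sandQ, sandOp_blockDiagonal α hB,
    matCpow_blockDiagonal fun x => sandOp_posSemidef α (hA x) (hB x), Matrix.trace_blockDiagonal,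
    Complex.re_sum]
  rfl

lemma petzQ_blockDiagonal (a : ℝ) {A B : κ → Matrix ι ι ℂ} (hA : ∀ x, (A x).PosSemidef)
    (hB : ∀ x, (B x).PosSemidef) :
    petzQ a (Matrix.blockDiagonal A) (Matrix.blockDiagonal B) = ∑ x, petzQ a (A x) (B x) := by
  rw [petzQ, matCpow_blockDiagonal hA, matCpow_blockDiagonal hB, ← Matrix.blockDiagonal_mul,
    Matrix.trace_blockDiagonal, Complex.re_sum]
  rfl

lemma sandQ_kronecker (α : ℝ) {A B : Matrix ι ι ℂ} {C D : Matrix κ κ ℂ} (hA : A.PosSemidef)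
    (hB : B.PosSemidef) (hC : C.PosSemidef) (hD : D.PosSemidef) :
    sandQ α (A ⊗ₖ C) (B ⊗ₖ D) = sandQ α A B * sandQ α C D := by
  have h : sandOp α (A ⊗ₖ C) (B ⊗ₖ D) = sandOp α A B ⊗ₖ sandOp α C D := by
    simp only [sandOp, matCpow_kronecker hB hD, Matrix.mul_kronecker_mul]
  rw [sandQ, h, matCpow_kronecker (sandOp_posSemidef α hA hB) (sandOp_posSemidef α hC hD),
    Matrix.trace_kronecker, sandQ_eq_trace α hA hB, sandQ_eq_trace α hC hD, ← Complex.ofReal_mul,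
    Complex.ofReal_re]

lemma petzQ_eq_trace (a : ℝ) {A B : Matrix ι ι ℂ} (hA : A.PosSemidef) (hB : B.PosSemidef) :
    (matCpow A (a : ℂ) * matCpow B ((1 - a : ℝ) : ℂ)).trace = (petzQ a A B : ℂ) := by
  rw [petzQ]
  have : (matCpow A (a : ℂ) * matCpow B ((1 - a : ℝ) : ℂ)).trace =
      (matCpow A ((a / 2 : ℝ) : ℂ) * matCpow B ((1 - a : ℝ) : ℂ) *
        (matCpow A ((a / 2 : ℝ) : ℂ))ᴴ).trace := by
    rw [matCpow_ofReal_conjTranspose hA, Matrix.trace_mul_comm _ (matCpow A ((a / 2 : ℝ) : ℂ)),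
      matCpow_mul_mul]
    congr 3; push_cast; ring
  rw [this]
  exact posSemidef_trace_eq_re ((matCpow_posSemidef hB _).mul_mul_conjTranspose_same _)

lemma petzQ_kronecker (a : ℝ) {A B : Matrix ι ι ℂ} {C D : Matrix κ κ ℂ} (hA : A.PosSemidef)
    (hB : B.PosSemidef) (hC : C.PosSemidef) (hD : D.PosSemidef) :
    petzQ a (A ⊗ₖ C) (B ⊗ₖ D) = petzQ a A B * petzQ a C D := by
  rw [petzQ, matCpow_kronecker hA hC, matCpow_kronecker hB hD, ← Matrix.mul_kronecker_mul,
    Matrix.trace_kronecker, petzQ_eq_trace a hA hB, petzQ_eq_trace a hC hD, ← Complex.ofReal_mul,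
    Complex.ofReal_re]

end Structure

section CqChannel

variable {R X B : Type} [Fintype R] [DecidableEq R] [Fintype X] [DecidableEq X] [Fintype B]
  [DecidableEq B]

/-- The diagonal block `⟨x|ρ|x⟩` of an operator on `R ⊗ X`. -/
def diagBlock (ρ : Matrix (R × X) (R × X) ℂ) (x : X) : Matrix R R ℂ :=
  ρ.submatrix (fun r => (r, x)) (fun r => (r, x))

/-- Kraus operators of the dephasing channel on `R ⊗ X`. -/
def dephasingKraus (R : Type) {X : Type} [DecidableEq R] [DecidableEq X] (x : X) :
    Matrix (R × X) (R × X) ℂ :=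
  Matrix.diagonal fun p => if p.2 = x then 1 else 0

/-- Kraus operators of the partial trace over the second factor. -/
def ptraceKraus (κ : Type) {X : Type} [DecidableEq κ] [DecidableEq X] (x : X) :
    Matrix κ (κ × X) ℂ :=
  fun p q => if p = q.1 ∧ q.2 = x then 1 else 0

omit [Fintype R] [DecidableEq R] [Fintype X] [DecidableEq X] in
lemma diagBlock_posSemidef {ρ : Matrix (R × X) (R × X) ℂ} (hρ : ρ.PosSemidef) (x : X) :
    (diagBlock ρ x).PosSemidef := hρ.submatrix _

lemma sum_dephasingKraus :
    ∑ x : X, (dephasingKraus R x)ᴴ * dephasingKraus R x = 1 := by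
  ext p q
  rw [Matrix.sum_apply]
  by_cases h : p = q
  · subst h
    simp [dephasingKraus, Matrix.diagonal_conjTranspose]
  · simp [dephasingKraus, Matrix.diagonal_conjTranspose, h]

lemma krausMap_dephasingKraus (ρ : Matrix (R × X) (R × X) ℂ) :
    krausMap (dephasingKraus R) ρ = Matrix.blockDiagonal (diagBlock ρ) := by
  ext p q
  rw [krausMap, Matrix.sum_apply, Matrix.blockDiagonal_apply]
  simp only [dephasingKraus, Matrix.diagonal_conjTranspose, Matrix.mul_diagonal,
    Matrix.diagonal_mul, diagBlock, Matrix.submatrix_apply]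
  rcases p with ⟨r, x⟩
  rcases q with ⟨s, y⟩
  by_cases h : x = y
  · subst h; simp [apply_ite star]
  · rw [if_neg h]
    refine Finset.sum_eq_zero fun z _ => ?_
    by_cases hx : x = z
    · subst hx; simp [Ne.symm h]
    · simp [hx]

lemma sum_ptraceKraus {κ : Type} [Fintype κ] [DecidableEq κ] :
    ∑ x : X, (ptraceKraus κ x)ᴴ * ptraceKraus κ x = 1 := by
  ext ⟨p, x⟩ ⟨q, y⟩
  rw [Matrix.sum_apply]
  simp only [Matrix.mul_apply, Matrix.conjTranspose_apply, ptraceKraus, Matrix.one_apply,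
    Prod.mk.injEq]
  rw [Finset.sum_eq_single x, Finset.sum_eq_single p]
  · by_cases h1 : p = q <;> by_cases h2 : x = y <;> simp [h1, h2, eq_comm]
  · intro b _ hb; simp [hb]
  · simp
  · intro z _ hz; simp [hz.symm]
  · simp

lemma krausMap_ptraceKraus {κ : Type} [Fintype κ] [DecidableEq κ] (D : X → Matrix κ κ ℂ) :
    krausMap (ptraceKraus κ) (Matrix.blockDiagonal D) = ∑ x, D x := by
  ext p q
  rw [krausMap, Matrix.sum_apply, Matrix.sum_apply]
  refine Finset.sum_congr rfl fun x _ => ?_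
  simp only [Matrix.mul_apply, Matrix.conjTranspose_apply, ptraceKraus,
    Matrix.blockDiagonal_apply, Fintype.sum_prod_type]
  rw [Finset.sum_eq_single q, Finset.sum_eq_single x, Finset.sum_eq_single p,
    Finset.sum_eq_single x]
  · simp
  · intro z _ hz; simp [hz]
  · simp
  · intro b _ hb; simp [hb.symm]
  · simp
  · intro z _ hz; simp [hz]
  · simp
  · intro b _ hb; simp [hb.symm]
  · simp

omit [Fintype R] [DecidableEq R] [DecidableEq X] [DecidableEq B] in
lemma idTensor_cqChannel (ν : X → Matrix B B ℂ) (ρ : Matrix (R × X) (R × X) ℂ) :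
    idTensor (cqChannel ν) ρ = ∑ x, diagBlock ρ x ⊗ₖ ν x := by
  ext p q
  simp [idTensor, cqChannel, Matrix.sum_apply, diagBlock]

lemma krausMap_ptraceKraus_cq (ν : X → Matrix B B ℂ) (ρ : Matrix (R × X) (R × X) ℂ) :
    krausMap (ptraceKraus (R × B)) (Matrix.blockDiagonal fun x => diagBlock ρ x ⊗ₖ ν x) =
      idTensor (cqChannel ν) ρ := by
  rw [krausMap_ptraceKraus, idTensor_cqChannel]

omit [DecidableEq R] [DecidableEq X] [DecidableEq B] in
lemma posSemidef_idTensor_cqChannel {ν : X → Matrix B B ℂ} (hν : ∀ x, (ν x).PosSemidef)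
    {ρ : Matrix (R × X) (R × X) ℂ} (hρ : ρ.PosSemidef) :
    (idTensor (cqChannel ν) ρ).PosSemidef := by
  rw [idTensor_cqChannel]
  exact Matrix.posSemidef_sum _ fun x _ => (diagBlock_posSemidef hρ x).kronecker (hν x)

variable {ν μ : X → Matrix B B ℂ} {ρ σ : Matrix (R × X) (R × X) ℂ}

lemma suppLE_diagBlock (hρ : ρ.PosSemidef) (hσ : σ.PosSemidef) (h : suppLE ρ σ) (x : X) :
    suppLE (diagBlock ρ x) (diagBlock σ x) := by
  have := h.krausMap hρ hσ (dephasingKraus R)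
  rw [krausMap_dephasingKraus, krausMap_dephasingKraus,
    suppLE_blockDiagonal_iff (diagBlock_posSemidef hρ) (diagBlock_posSemidef hσ)] at this
  exact this x

lemma suppLE_blockDiagonal_kronecker (hν : ∀ x, (ν x).PosSemidef) (hμ : ∀ x, (μ x).PosSemidef)
    (hρ : ρ.PosSemidef) (hσ : σ.PosSemidef) (h : suppLE ρ σ) (hνμ : ∀ x, suppLE (ν x) (μ x)) :
    suppLE (Matrix.blockDiagonal fun x => diagBlock ρ x ⊗ₖ ν x)
      (Matrix.blockDiagonal fun x => diagBlock σ x ⊗ₖ μ x) := by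
  rw [suppLE_blockDiagonal_iff (fun x => (diagBlock_posSemidef hρ x).kronecker (hν x))
    (fun x => (diagBlock_posSemidef hσ x).kronecker (hμ x))]
  exact fun x => (suppLE_diagBlock hρ hσ h x).kronecker (hνμ x) (diagBlock_posSemidef hρ x)
    (diagBlock_posSemidef hσ x) (hν x) (hμ x)

lemma suppLE_idTensor_cqChannel (hν : ∀ x, (ν x).PosSemidef) (hμ : ∀ x, (μ x).PosSemidef)
    (hρ : ρ.PosSemidef) (hσ : σ.PosSemidef) (h : suppLE ρ σ) (hνμ : ∀ x, suppLE (ν x) (μ x)) :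
    suppLE (idTensor (cqChannel ν) ρ) (idTensor (cqChannel μ) σ) := by
  rw [← krausMap_ptraceKraus_cq, ← krausMap_ptraceKraus_cq]
  exact (suppLE_blockDiagonal_kronecker hν hμ hρ hσ h hνμ).krausMap
    (posSemidef_blockDiagonal fun x => (diagBlock_posSemidef hρ x).kronecker (hν x))
    (posSemidef_blockDiagonal fun x => (diagBlock_posSemidef hσ x).kronecker (hμ x)) _

theorem sandQ_idTensor_cqChannel_le {α : ℝ} (hα : 1 < α) (hν : ∀ x, (ν x).PosSemidef)
    (hμ : ∀ x, (μ x).PosSemidef) (hρ : ρ.PosSemidef) (hσ : σ.PosSemidef) (h : suppLE ρ σ)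
    (hνμ : ∀ x, suppLE (ν x) (μ x)) {M : ℝ} (hM : ∀ x, sandQ α (ν x) (μ x) ≤ M) (hM0 : 0 ≤ M) :
    sandQ α (idTensor (cqChannel ν) ρ) (idTensor (cqChannel μ) σ) ≤ M * sandQ α ρ σ := by
  have hρ' := diagBlock_posSemidef hρ
  have hσ' := diagBlock_posSemidef hσ
  have hρν := fun x => (hρ' x).kronecker (hν x)
  have hσμ := fun x => (hσ' x).kronecker (hμ x)
  have h1 := sandQ_krausMap_le hα sum_ptraceKraus (posSemidef_blockDiagonal hρν)
    (posSemidef_blockDiagonal hσμ) ((suppLE_iff (posSemidef_blockDiagonal hρν)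
      (posSemidef_blockDiagonal hσμ)).1 (suppLE_blockDiagonal_kronecker hν hμ hρ hσ h hνμ))
  have h2 := sandQ_krausMap_le hα (sum_dephasingKraus (R := R) (X := X)) hρ hσ
    ((suppLE_iff hρ hσ).1 h)
  rw [krausMap_ptraceKraus_cq, krausMap_ptraceKraus_cq, sandQ_blockDiagonal α hρν hσμ] at h1
  rw [krausMap_dephasingKraus, krausMap_dephasingKraus, sandQ_blockDiagonal α hρ' hσ'] at h2
  refine h1.trans (le_trans ?_ (mul_le_mul_of_nonneg_left h2 hM0))
  rw [Finset.mul_sum]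
  refine Finset.sum_le_sum fun x _ => ?_
  rw [sandQ_kronecker α (hρ' x) (hσ' x) (hν x) (hμ x), mul_comm]
  exact mul_le_mul_of_nonneg_right (hM x) (sandQ_nonneg α (hρ' x) (hσ' x))

theorem le_sandQ_idTensor_cqChannel {α : ℝ} (hα : 1 / 2 ≤ α) (hα1 : α < 1)
    (hν : ∀ x, (ν x).PosSemidef) (hμ : ∀ x, (μ x).PosSemidef) (hρ : ρ.PosSemidef)
    (hσ : σ.PosSemidef) {M : ℝ} (hM : ∀ x, M ≤ sandQ α (ν x) (μ x)) (hM0 : 0 ≤ M) :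
    M * sandQ α ρ σ ≤ sandQ α (idTensor (cqChannel ν) ρ) (idTensor (cqChannel μ) σ) := by
  have hρ' := diagBlock_posSemidef hρ
  have hσ' := diagBlock_posSemidef hσ
  have hρν := fun x => (hρ' x).kronecker (hν x)
  have hσμ := fun x => (hσ' x).kronecker (hμ x)
  have h1 := le_sandQ_krausMap hα hα1 sum_ptraceKraus (posSemidef_blockDiagonal hρν)
    (posSemidef_blockDiagonal hσμ)
  have h2 := le_sandQ_krausMap hα hα1 (sum_dephasingKraus (R := R) (X := X)) hρ hσ
  rw [krausMap_ptraceKraus_cq, krausMap_ptraceKraus_cq, sandQ_blockDiagonal α hρν hσμ] at h1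
  rw [krausMap_dephasingKraus, krausMap_dephasingKraus, sandQ_blockDiagonal α hρ' hσ'] at h2
  refine (mul_le_mul_of_nonneg_left h2 hM0).trans (le_trans ?_ h1)
  rw [Finset.mul_sum]
  refine Finset.sum_le_sum fun x _ => ?_
  rw [sandQ_kronecker α (hρ' x) (hσ' x) (hν x) (hμ x), mul_comm]
  exact mul_le_mul_of_nonneg_left (hM x) (sandQ_nonneg α (hρ' x) (hσ' x))

theorem le_petzQ_idTensor_cqChannel {a : ℝ} (ha0 : 0 ≤ a) (ha1 : a ≤ 1)
    (hν : ∀ x, (ν x).PosSemidef) (hμ : ∀ x, (μ x).PosSemidef) (hρ : ρ.PosSemidef)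
    (hσ : σ.PosSemidef) {M : ℝ} (hM : ∀ x, M ≤ petzQ a (ν x) (μ x)) (hM0 : 0 ≤ M) :
    M * petzQ a ρ σ ≤ petzQ a (idTensor (cqChannel ν) ρ) (idTensor (cqChannel μ) σ) := by
  have hρ' := diagBlock_posSemidef hρ
  have hσ' := diagBlock_posSemidef hσ
  have hρν := fun x => (hρ' x).kronecker (hν x)
  have hσμ := fun x => (hσ' x).kronecker (hμ x)
  have h1 := petzQ_le_krausMap ha0 ha1 sum_ptraceKraus (posSemidef_blockDiagonal hρν)
    (posSemidef_blockDiagonal hσμ)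
  have h2 := petzQ_le_krausMap ha0 ha1 (sum_dephasingKraus (R := R) (X := X)) hρ hσ
  rw [krausMap_ptraceKraus_cq, krausMap_ptraceKraus_cq, petzQ_blockDiagonal a hρν hσμ] at h1
  rw [krausMap_dephasingKraus, krausMap_dephasingKraus, petzQ_blockDiagonal a hρ' hσ'] at h2
  refine (mul_le_mul_of_nonneg_left h2 hM0).trans (le_trans ?_ h1)
  rw [Finset.mul_sum]
  refine Finset.sum_le_sum fun x _ => ?_
  rw [petzQ_kronecker a (hρ' x) (hσ' x) (hν x) (hμ x), mul_comm]
  exact mul_le_mul_of_nonneg_left (hM x) (petzQ_nonneg a (hρ' x) (hσ' x))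

end CqChannel

section RelativeEntropy

open Filter Topology

variable {ι κ : Type} [Fintype ι] [DecidableEq ι] [Fintype κ] [DecidableEq κ]

lemma matLog2_eq_specFun (A : Matrix ι ι ℂ) :
    matLog2 A = specFun (fun x => (Real.logb 2 x : ℂ)) A := by
  rw [matLog2, hermFun_eq_specFun]
  congr 1
  ext x
  split_ifs with h <;> simp [h]

lemma hasDerivAt_matCpow_apply {A : Matrix ι ι ℂ} (hA : A.PosSemidef) (a : ℝ) (i j : ι) :
    HasDerivAt (fun a : ℝ => matCpow A (a : ℂ) i j)
      (Real.log 2 * (matCpow A (a : ℂ) * matLog2 A) i j) a := by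
  rw [matLog2_eq_specFun, matCpow, specFun_mul]
  simp only [matCpow, specFun, dif_pos hA.1, Matrix.mul_apply, Matrix.diagonal_apply, mul_ite,
    mul_zero, Finset.sum_ite_eq', Finset.mem_univ, if_true]
  rw [Finset.mul_sum]
  refine HasDerivAt.fun_sum fun k _ => ?_
  set x := hA.1.eigenvalues k with hx
  have hx0 : 0 ≤ x := hA.eigenvalues_nonneg k
  have hlog : (Real.log 2 : ℂ) * (Real.logb 2 x : ℂ) = Complex.log x := by
    rw [← Complex.ofReal_log hx0, ← Complex.ofReal_mul, Real.logb,
      mul_div_cancel₀ _ (Real.log_pos one_lt_two).ne']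
  split_ifs with h
  · simpa using hasDerivAt_const a (0 : ℂ)
  · have hd : HasDerivAt (fun a : ℝ => (x : ℂ) ^ (a : ℂ)) ((x : ℂ) ^ (a : ℂ) * Complex.log x) a := by
      have := (hasDerivAt_id (a : ℂ)).const_cpow (c := (x : ℂ))
        (Or.inl (by exact_mod_cast h))
      simpa using this.comp_ofReal
    refine ((hd.const_mul _).mul_const _).congr_deriv ?_
    rw [← hlog]; ring

/-- The value of the relative entropy when the support condition holds. -/
def relEntReal (A B : Matrix ι ι ℂ) : ℝ := ((A * (matLog2 A - matLog2 B)).trace).re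

lemma hasDerivAt_petzQ {A B : Matrix ι ι ℂ} (hA : A.PosSemidef) (hB : B.PosSemidef)
    (h : suppLE A B) :
    HasDerivAt (fun a => petzQ a A B) (Real.log 2 * relEntReal A B) 1 := by
  have hP := (suppLE_iff hA hB).1 h
  have hP' := mul_matCpow_zero_of hA hB hP
  have hderiv : HasDerivAt
      (fun a : ℝ => (matCpow A (a : ℂ) * matCpow B ((1 - a : ℝ) : ℂ)).trace)
      (Real.log 2 * (A * (matLog2 A - matLog2 B)).trace) 1 := by
    have h1 : (A * (matLog2 A - matLog2 B)).trace =
        (A * matLog2 A * matCpow B 0).trace - (A * (matCpow B 0 * matLog2 B)).trace := by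
      rw [← Matrix.mul_assoc, hP', Matrix.trace_mul_comm _ (matCpow B 0), ← Matrix.mul_assoc, hP,
        Matrix.mul_sub, Matrix.trace_sub]
    rw [h1]
    simp only [Matrix.trace, Matrix.diag, Matrix.mul_apply (M := A * matLog2 A),
      Matrix.mul_apply (M := A) (N := matCpow B 0 * matLog2 B)]
    rw [← Finset.sum_sub_distrib, Finset.mul_sum]
    refine HasDerivAt.fun_sum fun i _ => ?_
    rw [← Finset.sum_sub_distrib, Finset.mul_sum]
    refine HasDerivAt.fun_sum fun j _ => ?_
    have e1 := hasDerivAt_matCpow_apply hA 1 i j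
    have e2 : HasDerivAt (fun a : ℝ => matCpow B ((1 - a : ℝ) : ℂ) j i)
        (-(Real.log 2 * (matCpow B 0 * matLog2 B) j i)) 1 := by
      have e3 := hasDerivAt_matCpow_apply hB (1 - 1) j i
      have := HasDerivAt.scomp (1 : ℝ) e3 ((hasDerivAt_id (1 : ℝ)).const_sub 1)
      simpa [Function.comp_def] using this
    refine (e1.mul e2).congr_deriv ?_
    simp only [Complex.ofReal_one, matCpow_one hA, sub_self, Complex.ofReal_zero]
    ring
  have := Complex.reCLM.hasFDerivAt.comp_hasDerivAt (1 : ℝ) hderiv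
  rw [Complex.reCLM_apply, Complex.re_ofReal_mul] at this
  exact this

lemma petzQ_one {A B : Matrix ι ι ℂ} (hA : A.PosSemidef) (hB : B.PosSemidef) (h : suppLE A B) :
    petzQ 1 A B = A.trace.re := by
  have := mul_matCpow_zero_of hA hB ((suppLE_iff hA hB).1 h)
  simp [petzQ, matCpow_one hA, this]

lemma nonpos_of_hasDerivAt_of_nonneg_left {h : ℝ → ℝ} {d x : ℝ} (hd : HasDerivAt h d x)
    (hx : h x = 0) (hpos : ∀ᶠ a in 𝓝[<] x, 0 ≤ h a) : d ≤ 0 := by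
  have ht := (hasDerivAt_iff_tendsto_slope_left_right.1 hd).1
  refine le_of_tendsto ht ?_
  filter_upwards [hpos, self_mem_nhdsWithin] with a ha hax
  rw [slope_def_field, hx, sub_zero]
  exact div_nonpos_of_nonneg_of_nonpos ha (sub_nonpos.2 (le_of_lt hax))

lemma eventually_left_of_hasDerivAt {g : ℝ → ℝ} {d c x : ℝ} (hd : HasDerivAt g d x) (hc : d < c) :
    ∀ᶠ a in 𝓝[<] x, g x - (x - a) * c ≤ g a := by
  have ht := (hasDerivAt_iff_tendsto_slope_left_right.1 hd).1
  filter_upwards [ht.eventually (gt_mem_nhds hc), self_mem_nhdsWithin] with a ha hax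
  have hax' : 0 < x - a := sub_pos.2 hax
  rw [slope_def_field, ← neg_sub x a, ← neg_sub (g x) (g a), neg_div_neg_eq,
    div_lt_iff₀ hax'] at ha
  linarith

variable {R X B : Type} [Fintype R] [DecidableEq R] [Fintype X] [DecidableEq X] [Fintype B]
  [DecidableEq B]
  {ν μ : X → Matrix B B ℂ} {ρ σ : Matrix (R × X) (R × X) ℂ}

omit [DecidableEq R] [DecidableEq X] [DecidableEq B] in
lemma trace_idTensor_cqChannel (hν : ∀ x, (ν x).trace = 1) (ρ : Matrix (R × X) (R × X) ℂ) :
    (idTensor (cqChannel ν) ρ).trace = ρ.trace := by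
  rw [idTensor_cqChannel, Matrix.trace_sum]
  simp only [Matrix.trace_kronecker, hν, mul_one]
  simp only [Matrix.trace, Matrix.diag, diagBlock, Matrix.submatrix_apply, Fintype.sum_prod_type]
  exact Finset.sum_comm

lemma relEntReal_idTensor_cqChannel_le (hν : ∀ x, IsDensity (ν x)) (hμ : ∀ x, IsDensity (μ x))
    (hρ : IsDensity ρ) (hσ : IsDensity σ) (h : suppLE ρ σ) (hνμ : ∀ x, suppLE (ν x) (μ x))
    {M : ℝ} (hM : ∀ x, relEntReal (ν x) (μ x) ≤ M) :
    relEntReal (idTensor (cqChannel ν) ρ) (idTensor (cqChannel μ) σ) ≤ M + relEntReal ρ σ := by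
  have hl : 0 < Real.log 2 := Real.log_pos one_lt_two
  have hν1 := fun x => (hν x).1
  have hμ1 := fun x => (hμ x).1
  have hout := suppLE_idTensor_cqChannel hν1 hμ1 hρ.1 hσ.1 h hνμ
  have hoρ := posSemidef_idTensor_cqChannel hν1 hρ.1
  have hoσ := posSemidef_idTensor_cqChannel hμ1 hσ.1
  refine le_of_forall_pos_le_add fun ε hε => ?_
  set c := Real.log 2 * (M + ε) with hc
  have hx : ∀ᶠ a in 𝓝[<] (1 : ℝ), ∀ x, 1 - (1 - a) * c ≤ petzQ a (ν x) (μ x) := by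
    rw [eventually_all]
    intro x
    have := eventually_left_of_hasDerivAt (c := c) (hasDerivAt_petzQ (hν1 x) (hμ1 x) (hνμ x))
      (mul_lt_mul_of_pos_left (by linarith [hM x]) hl)
    rwa [petzQ_one (hν1 x) (hμ1 x) (hνμ x), (hν x).2, Complex.one_re] at this
  have hpos : ∀ᶠ a in 𝓝[<] (1 : ℝ), 0 ≤ 1 - (1 - a) * c := by
    have : Tendsto (fun a : ℝ => 1 - (1 - a) * c) (𝓝[<] 1) (𝓝 1) := by
      have : Continuous fun a : ℝ => 1 - (1 - a) * c := by fun_prop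
      have := this.tendsto 1
      simp only [sub_self, zero_mul, sub_zero] at this
      exact this.mono_left nhdsWithin_le_nhds
    filter_upwards [this.eventually (lt_mem_nhds zero_lt_one)] with a ha using ha.le
  have h01 : ∀ᶠ a in 𝓝[<] (1 : ℝ), 0 ≤ a := by
    filter_upwards [nhdsWithin_le_nhds (lt_mem_nhds (zero_lt_one (α := ℝ)))] with a ha using
      le_of_lt ha
  have hd := (hasDerivAt_petzQ hoρ hoσ hout).sub
    (((((hasDerivAt_id (1 : ℝ)).const_sub 1).mul_const c).const_sub 1).mul
      (hasDerivAt_petzQ hρ.1 hσ.1 h))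
  have := nonpos_of_hasDerivAt_of_nonneg_left hd ?_ ?_
  · simp only [id, petzQ_one hρ.1 hσ.1 h, hρ.2, Complex.one_re] at this
    have h2 : Real.log 2 * relEntReal (idTensor (cqChannel ν) ρ) (idTensor (cqChannel μ) σ) ≤
        Real.log 2 * (M + relEntReal ρ σ + ε) := by
      rw [hc] at this; linarith
    exact le_of_mul_le_mul_left h2 hl
  · simp [petzQ_one hρ.1 hσ.1 h, petzQ_one hoρ hoσ hout,
      trace_idTensor_cqChannel (fun x => (hν x).2)]
  · filter_upwards [hx, hpos, h01, self_mem_nhdsWithin] with a h1 h2 h3 h4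
    exact sub_nonneg.2 (le_petzQ_idTensor_cqChannel h3 (le_of_lt h4) hν1 hμ1 hρ.1 hσ.1 h1 h2)

end RelativeEntropy

section AmortizationCollapse

variable {ι κ : Type} [Fintype ι] [DecidableEq ι] [Fintype κ] [DecidableEq κ]

lemma sandQ_eq_matPow (α : ℝ) {A B : Matrix ι ι ℂ} (hA : A.PosSemidef) (hB : B.PosSemidef) :
    ((matPow (matPow B ((1 - α) / (2 * α)) * A * matPow B ((1 - α) / (2 * α))) α).trace).re =
      sandQ α A B := by
  rw [matPow_eq_matCpow hB, sandQ, ← matPow_eq_matCpow (sandOp_posSemidef α hA hB)]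
  rfl

lemma sandRenyi_of_one_lt {α : ℝ} (hα : 1 < α) {A B : Matrix ι ι ℂ} (hA : A.PosSemidef)
    (hB : B.PosSemidef) (h : suppLE A B) :
    sandRenyi α A B = (((α - 1)⁻¹ * Real.logb 2 (sandQ α A B) : ℝ) : EReal) := by
  rw [sandRenyi, if_neg hα.ne', if_neg (by tauto), if_neg fun h' => hα.not_gt h'.1,
    sandQ_eq_matPow α hA hB]

lemma sandRenyi_of_lt_one {α : ℝ} (hα : α < 1) {A B : Matrix ι ι ℂ} (hA : A.PosSemidef)
    (hB : B.PosSemidef) (h : A * B ≠ 0) :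
    sandRenyi α A B = (((α - 1)⁻¹ * Real.logb 2 (sandQ α A B) : ℝ) : EReal) := by
  rw [sandRenyi, if_neg hα.ne, if_neg fun h' => hα.not_gt h'.1,
    if_neg fun h' => h ((trace_mul_eq_zero_iff hA hB).1 h'.2), sandQ_eq_matPow α hA hB]

lemma sandRenyi_one {A B : Matrix ι ι ℂ} (h : suppLE A B) :
    sandRenyi 1 A B = (relEntReal A B : EReal) := by
  rw [sandRenyi, if_pos rfl, relEnt, if_pos h, relEntReal]

lemma sandRenyi_eq_top_of_not_suppLE {α : ℝ} (hα : 1 ≤ α) {A B : Matrix ι ι ℂ}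
    (h : ¬ suppLE A B) : sandRenyi α A B = ⊤ := by
  rcases hα.eq_or_lt with rfl | hα
  · rw [sandRenyi, if_pos rfl, relEnt, if_neg h]
  · rw [sandRenyi, if_neg hα.ne', if_pos ⟨hα, h⟩]

lemma sandRenyi_eq_top_of_mul_eq_zero {α : ℝ} (hα : α < 1) {A B : Matrix ι ι ℂ}
    (h : A * B = 0) : sandRenyi α A B = ⊤ := by
  rw [sandRenyi, if_neg hα.ne, if_neg fun h' => hα.not_gt h'.1, if_pos ⟨hα, by simp [h]⟩]

omit [DecidableEq ι] in
lemma IsDensity.ne_zero {A : Matrix ι ι ℂ} (hA : IsDensity A) : A ≠ 0 := by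
  rintro rfl
  simpa using hA.2

lemma sandQ_pos_of_suppLE (α : ℝ) {A B : Matrix ι ι ℂ} (hA : IsDensity A) (hB : B.PosSemidef)
    (h : suppLE A B) : 0 < sandQ α A B :=
  (sandQ_nonneg α hA.1 hB).lt_of_ne' fun h0 =>
    hA.ne_zero (eq_zero_of_suppLE hA.1 hB h ((sandQ_eq_zero_iff α hA.1 hB).1 h0))

lemma sandQ_pos_of_mul_ne_zero (α : ℝ) {A B : Matrix ι ι ℂ} (hA : A.PosSemidef)
    (hB : B.PosSemidef) (h : A * B ≠ 0) : 0 < sandQ α A B :=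
  (sandQ_nonneg α hA hB).lt_of_ne' fun h0 => h ((sandQ_eq_zero_iff α hA hB).1 h0)

section Submatrix

variable (e : κ ≃ ι)

omit [DecidableEq ι] [DecidableEq κ] in
lemma trace_submatrix_equiv (A : Matrix ι ι ℂ) : (A.submatrix e e).trace = A.trace :=
  e.sum_comp fun i => A i i

omit [DecidableEq ι] [DecidableEq κ] in
lemma suppLE_submatrix_iff {A B : Matrix ι ι ℂ} :
    suppLE (A.submatrix e e) (B.submatrix e e) ↔ suppLE A B := by
  have key (C : Matrix ι ι ℂ) (v : κ → ℂ) :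
      (C.submatrix e e).mulVec v = 0 ↔ C.mulVec (v ∘ e.symm) = 0 := by
    rw [Matrix.submatrix_mulVec_equiv]
    constructor
    · intro h
      ext i
      simpa using congrFun h (e.symm i)
    · intro h
      rw [h]; rfl
  simp only [suppLE, key]
  constructor
  · intro h v hv
    have := h (v ∘ e) (by simpa [Function.comp_assoc] using hv)
    simpa [Function.comp_assoc] using this
  · exact fun h v hv => h _ hv

lemma sandQ_submatrix (α : ℝ) {A B : Matrix ι ι ℂ} (hA : A.PosSemidef) (hB : B.PosSemidef) :
    sandQ α (A.submatrix e e) (B.submatrix e e) = sandQ α A B := by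
  have h : sandOp α (A.submatrix e e) (B.submatrix e e) = (sandOp α A B).submatrix e e := by
    simp only [sandOp, matCpow]
    rw [specFun_submatrix _ hB, Matrix.submatrix_mul_equiv, Matrix.submatrix_mul_equiv]
  rw [sandQ, h, matCpow, specFun_submatrix _ (sandOp_posSemidef α hA hB),
    trace_submatrix_equiv]
  rfl

lemma relEntReal_submatrix {A B : Matrix ι ι ℂ} (hA : A.PosSemidef) (hB : B.PosSemidef) :
    relEntReal (A.submatrix e e) (B.submatrix e e) = relEntReal A B := by
  simp only [relEntReal, matLog2_eq_specFun]
  rw [specFun_submatrix _ hB, specFun_submatrix _ hA, Matrix.mul_sub, Matrix.mul_sub,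
    Matrix.submatrix_mul_equiv, Matrix.submatrix_mul_equiv, Matrix.trace_sub, Matrix.trace_sub,
    trace_submatrix_equiv, trace_submatrix_equiv]

lemma sandRenyi_submatrix (α : ℝ) {A B : Matrix ι ι ℂ} (hA : A.PosSemidef) (hB : B.PosSemidef) :
    sandRenyi α (A.submatrix e e) (B.submatrix e e) = sandRenyi α A B := by
  rw [sandRenyi, sandRenyi, sandQ_eq_matPow α hA hB, sandQ_eq_matPow α (hA.submatrix e)
    (hB.submatrix e), sandQ_submatrix e α hA hB, Matrix.submatrix_mul_equiv,
    trace_submatrix_equiv, relEnt, relEnt]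
  simp only [suppLE_submatrix_iff]
  have := relEntReal_submatrix e hA hB
  simp only [relEntReal] at this
  rw [this]

end Submatrix

lemma isDensity_dephasingKraus [Unique ι] (x : κ) : IsDensity (dephasingKraus ι x) := by
  constructor
  · refine Matrix.PosSemidef.diagonal fun p => ?_
    dsimp only
    split_ifs <;> simp
  · rw [dephasingKraus, Matrix.trace_diagonal, Fintype.sum_prod_type]
    simp

lemma dephasingKraus_mul_self (x : κ) :
    dephasingKraus ι x * dephasingKraus ι x = dephasingKraus ι x := by
  rw [dephasingKraus, Matrix.diagonal_mul_diagonal]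
  congr 1
  ext p
  split_ifs <;> simp

lemma matCpow_dephasingKraus (x : κ) (z : ℂ) :
    matCpow (dephasingKraus ι x) z = dephasingKraus ι x := by
  have h := specFun_unitary_diagonal (fun y => if y = 0 then 0 else (y : ℂ) ^ z)
    (U := (1 : Matrix (ι × κ) (ι × κ) ℂ)) (by simp) (by simp)
    (fun p => if p.2 = x then 1 else 0)
  simp only [Matrix.conjTranspose_one, Matrix.one_mul, Matrix.mul_one] at h
  have h1 : dephasingKraus ι x =
      Matrix.diagonal fun p : ι × κ => (((if p.2 = x then 1 else 0 : ℝ)) : ℂ) := by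
    rw [dephasingKraus]
    congr 1
    ext p
    split_ifs <;> simp
  rw [matCpow, h1, h]
  congr 1
  ext p
  split_ifs <;> simp_all

lemma sandRenyi_dephasingKraus_self [Unique ι] (α : ℝ) (x : κ) :
    sandRenyi α (dephasingKraus ι x) (dephasingKraus ι x) = 0 := by
  have hd := isDensity_dephasingKraus (ι := ι) x
  have hs : suppLE (dephasingKraus ι x) (dephasingKraus ι x) := fun _ h => h
  have hQ : sandQ α (dephasingKraus ι x) (dephasingKraus ι x) = 1 := by
    rw [sandQ, sandOp]
    simp only [matCpow_dephasingKraus, dephasingKraus_mul_self, hd.2, Complex.one_re]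
  rcases lt_trichotomy α 1 with h | rfl | h
  · rw [sandRenyi_of_lt_one h hd.1 hd.1 (by rw [dephasingKraus_mul_self]; exact hd.ne_zero), hQ]
    simp
  · rw [sandRenyi_one hs]
    simp [relEntReal]
  · rw [sandRenyi_of_one_lt h hd.1 hd.1 hs, hQ]
    simp

omit [Fintype ι] in
lemma idTensor_cqChannel_dephasingKraus [Unique ι] {B : Type} [Fintype B]
    (ν : κ → Matrix B B ℂ) (x : κ) :
    idTensor (cqChannel ν) (dephasingKraus ι x) =
      (ν x).submatrix (Equiv.uniqueProd B ι) (Equiv.uniqueProd B ι) := by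
  ext p q
  simp only [idTensor, cqChannel, dephasingKraus, Subsingleton.elim q.1 p.1,
    Matrix.diagonal_apply_eq, ite_smul, one_smul, zero_smul, Finset.sum_ite_eq', Finset.mem_univ,
    if_true]
  rfl

variable {R X B : Type} [Fintype R] [DecidableEq R] [Fintype X] [DecidableEq X] [Nonempty X]
  [Fintype B] [DecidableEq B] {ν μ : X → Matrix B B ℂ} {ρ σ : Matrix (R × X) (R × X) ℂ}

lemma exists_sandRenyi_sub_le_of_one_lt {α : ℝ} (hα : 1 < α) (hν : ∀ x, IsDensity (ν x))
    (hμ : ∀ x, IsDensity (μ x)) (hρ : IsDensity ρ) (hσ : IsDensity σ) (h : suppLE ρ σ)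
    (hνμ : ∀ x, suppLE (ν x) (μ x)) :
    ∃ x, sandRenyi α (idTensor (cqChannel ν) ρ) (idTensor (cqChannel μ) σ) - sandRenyi α ρ σ ≤
      sandRenyi α (ν x) (μ x) := by
  have hν1 := fun x => (hν x).1
  have hμ1 := fun x => (hμ x).1
  have hout := suppLE_idTensor_cqChannel hν1 hμ1 hρ.1 hσ.1 h hνμ
  have hoρ : IsDensity (idTensor (cqChannel ν) ρ) :=
    ⟨posSemidef_idTensor_cqChannel hν1 hρ.1, by
      rw [trace_idTensor_cqChannel fun x => (hν x).2, hρ.2]⟩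
  have hoσ := posSemidef_idTensor_cqChannel hμ1 hσ.1
  obtain ⟨x, hx⟩ := Finite.exists_max fun x => sandQ α (ν x) (μ x)
  refine ⟨x, ?_⟩
  have hM := sandQ_pos_of_suppLE α (hν x) (hμ1 x) (hνμ x)
  have hQ := sandQ_pos_of_suppLE α hρ hσ.1 h
  rw [sandRenyi_of_one_lt hα hoρ.1 hoσ hout, sandRenyi_of_one_lt hα hρ.1 hσ.1 h,
    sandRenyi_of_one_lt hα (hν1 x) (hμ1 x) (hνμ x), ← EReal.coe_sub, EReal.coe_le_coe_iff,
    ← mul_sub]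
  refine mul_le_mul_of_nonneg_left ?_ (inv_nonneg.2 (sub_nonneg.2 hα.le))
  rw [sub_le_iff_le_add, ← Real.logb_mul hM.ne' hQ.ne']
  exact Real.logb_le_logb_of_le one_lt_two (sandQ_pos_of_suppLE α hoρ hoσ hout)
    (sandQ_idTensor_cqChannel_le hα hν1 hμ1 hρ.1 hσ.1 h hνμ hx hM.le)

lemma exists_sandRenyi_sub_le_of_lt_one {α : ℝ} (hα : 1 / 2 ≤ α) (hα1 : α < 1)
    (hν : ∀ x, (ν x).PosSemidef) (hμ : ∀ x, (μ x).PosSemidef) (hρ : ρ.PosSemidef)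
    (hσ : σ.PosSemidef) (h : ρ * σ ≠ 0) (hνμ : ∀ x, ν x * μ x ≠ 0) :
    ∃ x, sandRenyi α (idTensor (cqChannel ν) ρ) (idTensor (cqChannel μ) σ) - sandRenyi α ρ σ ≤
      sandRenyi α (ν x) (μ x) := by
  have hoρ := posSemidef_idTensor_cqChannel hν hρ
  have hoσ := posSemidef_idTensor_cqChannel hμ hσ
  obtain ⟨x, hx⟩ := Finite.exists_min fun x => sandQ α (ν x) (μ x)
  refine ⟨x, ?_⟩
  have hM := sandQ_pos_of_mul_ne_zero α (hν x) (hμ x) (hνμ x)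
  have hQ := sandQ_pos_of_mul_ne_zero α hρ hσ h
  have hle := le_sandQ_idTensor_cqChannel hα hα1 hν hμ hρ hσ hx hM.le
  have hout := fun h0 => ((mul_pos hM hQ).trans_le hle).ne' ((sandQ_eq_zero_iff α hoρ hoσ).2 h0)
  rw [sandRenyi_of_lt_one hα1 hoρ hoσ hout, sandRenyi_of_lt_one hα1 hρ hσ h,
    sandRenyi_of_lt_one hα1 (hν x) (hμ x) (hνμ x), ← EReal.coe_sub, EReal.coe_le_coe_iff,
    ← mul_sub]
  refine mul_le_mul_of_nonpos_left ?_ (inv_nonpos.2 (sub_nonpos.2 hα1.le))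
  rw [le_sub_iff_add_le, ← Real.logb_mul hM.ne' hQ.ne']
  exact Real.logb_le_logb_of_le one_lt_two (mul_pos hM hQ) hle

lemma exists_relEnt_sub_le (hν : ∀ x, IsDensity (ν x)) (hμ : ∀ x, IsDensity (μ x))
    (hρ : IsDensity ρ) (hσ : IsDensity σ) (h : suppLE ρ σ) (hνμ : ∀ x, suppLE (ν x) (μ x)) :
    ∃ x, sandRenyi 1 (idTensor (cqChannel ν) ρ) (idTensor (cqChannel μ) σ) - sandRenyi 1 ρ σ ≤
      sandRenyi 1 (ν x) (μ x) := by
  have hout := suppLE_idTensor_cqChannel (fun x => (hν x).1) (fun x => (hμ x).1) hρ.1 hσ.1 h hνμ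
  obtain ⟨x, hx⟩ := Finite.exists_max fun x => relEntReal (ν x) (μ x)
  refine ⟨x, ?_⟩
  rw [sandRenyi_one hout, sandRenyi_one h, sandRenyi_one (hνμ x), ← EReal.coe_sub,
    EReal.coe_le_coe_iff, sub_le_iff_le_add]
  exact relEntReal_idTensor_cqChannel_le hν hμ hρ hσ h hνμ hx

theorem sandRenyi_idTensor_cqChannel_sub_le {α : ℝ} (hα : 1 / 2 ≤ α)
    (hν : ∀ x, IsDensity (ν x)) (hμ : ∀ x, IsDensity (μ x)) (hρ : IsDensity ρ)
    (hσ : IsDensity σ) :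
    sandRenyi α (idTensor (cqChannel ν) ρ) (idTensor (cqChannel μ) σ) - sandRenyi α ρ σ ≤
      ⨆ x, sandRenyi α (ν x) (μ x) := by
  by_cases hin : sandRenyi α ρ σ = ⊤
  · simp [hin]
  by_cases hx : ∃ x, sandRenyi α (ν x) (μ x) = ⊤
  · obtain ⟨x, hx⟩ := hx
    exact le_top.trans (hx ▸ le_iSup (fun x => sandRenyi α (ν x) (μ x)) x)
  push Not at hx
  suffices ∃ x, sandRenyi α (idTensor (cqChannel ν) ρ) (idTensor (cqChannel μ) σ) -
      sandRenyi α ρ σ ≤ sandRenyi α (ν x) (μ x) by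
    obtain ⟨x, h⟩ := this
    exact h.trans (le_iSup (fun x => sandRenyi α (ν x) (μ x)) x)
  rcases lt_or_ge α 1 with h1 | h1
  · exact exists_sandRenyi_sub_le_of_lt_one hα h1 (fun x => (hν x).1) (fun x => (hμ x).1) hρ.1
      hσ.1 (fun h => hin (sandRenyi_eq_top_of_mul_eq_zero h1 h))
      (fun x h => hx x (sandRenyi_eq_top_of_mul_eq_zero h1 h))
  · have hs : suppLE ρ σ := by_contra fun h => hin (sandRenyi_eq_top_of_not_suppLE h1 h)
    have hsx (x) : suppLE (ν x) (μ x) :=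
      by_contra fun h => hx x (sandRenyi_eq_top_of_not_suppLE h1 h)
    rcases h1.eq_or_lt with rfl | h1
    · exact exists_relEnt_sub_le hν hμ hρ hσ hs hsx
    · exact exists_sandRenyi_sub_le_of_one_lt h1 hν hμ hρ hσ hs hsx

end AmortizationCollapse

/-- Amortization collapse of the sandwiched Rényi divergences for
classical-quantum channels: for `α ≥ 1/2`, `D̃_α^𝒜(N‖M) = max_x D̃_α(ν^x‖μ^x)`. -/
theorem cq_sandRenyi_amortization_collapse
    {X B : Type} [Fintype X] [DecidableEq X] [Nonempty X] [Fintype B] [DecidableEq B]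
    (ν μ : X → Matrix B B ℂ) (hν : ∀ x, IsDensity (ν x)) (hμ : ∀ x, IsDensity (μ x))
    (α : ℝ) (hα : (1/2 : ℝ) ≤ α) :
    amortizedDiv (sandFam α) (cqChannel ν) (cqChannel μ) = ⨆ x, sandRenyi α (ν x) (μ x) := by
  refine le_antisymm ?_ (iSup_le fun x => ?_)
  · refine iSup_le fun R => iSup_le fun ρ => iSup_le fun σ => iSup_le fun hρ => iSup_le fun hσ => ?_
    convert sandRenyi_idTensor_cqChannel_sub_le hα hν hμ hρ hσ <;> rfl
  · have hd := isDensity_dephasingKraus (ι := Fin 1) x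
    refine le_trans (le_of_eq ?_) (le_iSup_of_le 1 <| le_iSup_of_le (dephasingKraus (Fin 1) x) <|
      le_iSup_of_le (dephasingKraus (Fin 1) x) <| le_iSup_of_le hd <| le_iSup_of_le hd le_rfl)
    have h0 := sandRenyi_dephasingKraus_self (ι := Fin 1) α x
    have h1 := sandRenyi_submatrix (Equiv.uniqueProd B (Fin 1)) α (hν x).1 (hμ x).1
    rw [← idTensor_cqChannel_dephasingKraus, ← idTensor_cqChannel_dephasingKraus] at h1
    rw [← h1, ← sub_zero (sandRenyi α _ _), ← h0]
    simp only [sandFam]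

end
end

section
/- Let N, M : A → B be environment-parametrized quantum channels, i.e., there exist a finite-dimensional environment E, density matrices θ_E^N and θ_E^M on E, and a fixed quantum channel P : A⊗E → B such that N(ρ) = P(ρ ⊗ θ_E^N) and M(ρ) = P(ρ ⊗ θ_E^M) for all inputs ρ. Then for any generalized divergence D that is sub-additive with respect to tensor-product states, the amortized channel divergence is bounded by the divergence of the environment states: D^A(N‖M) ≤ D(θ_E^N ‖ θ_E^M). -/
open scoped BigOperators ComplexOrder

noncomputable section

attribute [local instance] Classical.propDecidable

/-- Amplifying a channel by a reference system, with the input regrouped as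
`(R ⊗ A) ⊗ E`, gives a channel. -/
theorem IsChannel.idTensor_assoc {ι E κ : Type} [Fintype ι] [Fintype E] [Fintype κ]
    {P : Matrix (ι × E) (ι × E) ℂ → Matrix κ κ ℂ} (hP : IsChannel P) (R : ℕ) :
    IsChannel fun X : Matrix ((Fin R × ι) × E) ((Fin R × ι) × E) ℂ =>
      idTensor P (X.submatrix (Equiv.prodAssoc (Fin R) ι E).symm
        (Equiv.prodAssoc (Fin R) ι E).symm) where
  linear :=
    { map_add := fun X Y => by
        ext p q
        exact congrFun₂ (hP.linear.map_add
          (fun a b => X ((p.1, a.1), a.2) ((q.1, b.1), b.2))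
          (fun a b => Y ((p.1, a.1), a.2) ((q.1, b.1), b.2))) p.2 q.2
      map_smul := fun c X => by
        ext p q
        exact congrFun₂ (hP.linear.map_smul c
          (fun a b => X ((p.1, a.1), a.2) ((q.1, b.1), b.2))) p.2 q.2 }
  tracePres X := by
    have h (r : Fin R) := hP.tracePres (fun a b => X ((r, a.1), a.2) ((r, b.1), b.2))
    simp only [Matrix.trace, Matrix.diag, Fintype.sum_prod_type] at h ⊢
    exact Finset.sum_congr rfl fun r _ => h r
  compPos k X hX := by
    let f : Fin (k * R) × (ι × E) → Fin k × ((Fin R × ι) × E) := fun p =>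
      ((finProdFinEquiv.symm p.1).1, (((finProdFinEquiv.symm p.1).2, p.2.1), p.2.2))
    let e : Fin k × (Fin R × κ) → Fin (k * R) × κ := fun p =>
      (finProdFinEquiv (p.1, p.2.1), p.2.2)
    convert (hP.compPos (k * R) _ (hX.submatrix f)).submatrix e using 1
    ext p q
    simp only [idTensor, f, e, Matrix.submatrix_apply, Equiv.symm_apply_apply]
    rfl

/-- The tensor product of two density matrices is a density matrix. -/
theorem IsDensity.mkron {ι E : Type} [Fintype ι] [Fintype E]
    {ρ : Matrix ι ι ℂ} {ω : Matrix E E ℂ} (hρ : IsDensity ρ) (hω : IsDensity ω) :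
    IsDensity (mkron ρ ω) :=
  ⟨hρ.1.kronecker hω.1, (Matrix.trace_kronecker ρ ω).trans (by rw [hρ.2, hω.2, one_mul])⟩

/-- For environment-parametrized channels and a sub-additive generalized
divergence, the amortized channel divergence is bounded by the divergence of the environment
states. -/
theorem env_param_amortized_le
    (D : DivFam) (hdp : DivDataProcessing D) (hsub : DivSubAdditive D)
    {ι κ E : Type} [Fintype ι] [DecidableEq ι] [Fintype κ] [DecidableEq κ]
    [Fintype E] [DecidableEq E]
    (P : Matrix (ι × E) (ι × E) ℂ → Matrix κ κ ℂ) (hP : IsChannel P)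
    (θN θM : Matrix E E ℂ) (hθN : IsDensity θN) (hθM : IsDensity θM)
    (N M : Matrix ι ι ℂ → Matrix κ κ ℂ) (hN : IsChannel N) (hM : IsChannel M)
    (hNP : ∀ ρ : Matrix ι ι ℂ, N ρ = P (mkron ρ θN))
    (hMP : ∀ ρ : Matrix ι ι ℂ, M ρ = P (mkron ρ θM)) :
    amortizedDiv D N M ≤ D E θN θM := by
  refine iSup_le fun R => iSup_le fun ρ => iSup_le fun σ => iSup_le fun hρ => iSup_le fun hσ => ?_
  have hNR : idTensor N ρ = idTensor P ((mkron ρ θN).submatrix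
      (Equiv.prodAssoc (Fin R) ι E).symm (Equiv.prodAssoc (Fin R) ι E).symm) := by
    ext p q
    exact congrFun₂ (hNP _) p.2 q.2
  have hMR : idTensor M σ = idTensor P ((mkron σ θM).submatrix
      (Equiv.prodAssoc (Fin R) ι E).symm (Equiv.prodAssoc (Fin R) ι E).symm) := by
    ext p q
    exact congrFun₂ (hMP _) p.2 q.2
  rw [hNR, hMR]
  refine EReal.sub_le_of_le_add' ?_
  exact (hdp _ _ _ (hP.idTensor_assoc R) _ _ (hρ.mkron hθN) (hσ.mkron hθM)).trans
    (hsub _ _ ρ σ θN θM hρ hσ hθN hθM)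
end
end

section
/- Energy-constrained amortization collapse for replacer channels: let N : A → B be a quantum channel and let R : A → B be the replacer channel R(X) = Tr[X]·τ_B for a fixed density matrix τ_B on B. Let H_A be a positive semidefinite Hamiltonian matrix on A and E ≥ 0 an energy constraint such that at least one density matrix ρ_A on A satisfies Tr[H_A ρ_A] ≤ E. Then the energy-constrained amortized quantum relative entropy divergence collapses: D^A_{H,E}(N‖R) = D_{H,E}(N‖R), where D_{H,E}(N‖R) := sup over finite-dimensional references R' and density matrices ψ on R'⊗A with Tr[H_A ψ_A] ≤ E of D((id⊗N)(ψ) ‖ (id⊗R)(ψ)). -/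
open scoped BigOperators ComplexOrder

noncomputable section

attribute [local instance] Classical.propDecidable

open Matrix Kronecker

section SpectralCalculus

variable {n : Type} [Fintype n] [DecidableEq n]

lemma isHermitian_conj_diagonal (U : Matrix n n ℂ) (d : n → ℝ) :
    (U * diagonal (fun i => (d i : ℂ)) * star U).IsHermitian := by
  have h : (diagonal (fun i => (d i : ℂ))).IsHermitian := by
    rw [Matrix.isHermitian_diagonal_iff]
    intro i
    simp [IsSelfAdjoint]
  simpa [star_eq_conjTranspose] using isHermitian_mul_mul_conjTranspose U h

/-- The spectral calculus may be computed in any unitary diagonalization. -/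
lemma hermFun_conj_diagonal (f : ℝ → ℝ) {U : Matrix n n ℂ} (hU : U ∈ unitaryGroup n ℂ)
    (d : n → ℝ) :
    hermFun f (U * diagonal (fun i => (d i : ℂ)) * star U) =
      U * diagonal (fun i => (f (d i) : ℂ)) * star U := by
  have hA := isHermitian_conj_diagonal U d
  rw [hermFun, dif_pos hA]
  set V : Matrix n n ℂ := (hA.eigenvectorUnitary : Matrix n n ℂ) with hV
  have hV1 : star V * V = 1 := (mem_unitaryGroup_iff').1 hA.eigenvectorUnitary.2
  have hV2 : V * star V = 1 := (mem_unitaryGroup_iff).1 hA.eigenvectorUnitary.2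
  have hU1 : star U * U = 1 := (mem_unitaryGroup_iff').1 hU
  have hU2 : U * star U = 1 := (mem_unitaryGroup_iff).1 hU
  set e := hA.eigenvalues
  have hs : U * diagonal (fun i => (d i : ℂ)) * star U =
      V * diagonal (fun i => (e i : ℂ)) * star V := by
    have := hA.spectral_theorem
    rw [Unitary.conjStarAlgAut_apply] at this
    exact this
  have hW : diagonal (fun i => (e i : ℂ)) * (star V * U) =
      (star V * U) * diagonal (fun i => (d i : ℂ)) := by
    calc diagonal (fun i => (e i : ℂ)) * (star V * U)
        = (star V * V) * diagonal (fun i => (e i : ℂ)) * (star V * U) := by rw [hV1, one_mul]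
      _ = star V * (V * diagonal (fun i => (e i : ℂ)) * star V) * U := by
          simp only [mul_assoc]
      _ = (star V * U) * diagonal (fun i => (d i : ℂ)) * (star U * U) := by
          rw [← hs]; simp only [mul_assoc]
      _ = _ := by rw [hU1, mul_one]
  have hfW : diagonal (fun i => (f (e i) : ℂ)) * (star V * U) =
      (star V * U) * diagonal (fun i => (f (d i) : ℂ)) := by
    ext i j
    have hij := congrFun (congrFun hW i) j
    rw [diagonal_mul, mul_diagonal] at hij ⊢
    by_cases h0 : (star V * U) i j = 0
    · simp [h0]
    · have : (e i : ℂ) = d j := by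
        rw [mul_comm] at hij
        exact mul_left_cancel₀ h0 hij
      rw [Complex.ofReal_inj.1 this, mul_comm]
  calc V * diagonal (fun i => (f (e i) : ℂ)) * star V
      = V * (diagonal (fun i => (f (e i) : ℂ)) * (star V * U)) * star U := by
        simp only [mul_assoc]; rw [hU2, mul_one]
    _ = (V * star V) * U * diagonal (fun i => (f (d i) : ℂ)) * star U := by
        rw [hfW]; simp only [mul_assoc]
    _ = _ := by rw [hV2, one_mul]

lemma exists_conj_diagonal {A : Matrix n n ℂ} (hA : A.PosSemidef) :
    ∃ U ∈ unitaryGroup n ℂ, ∃ d : n → ℝ, (∀ i, 0 ≤ d i) ∧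
      A = U * diagonal (fun i => (d i : ℂ)) * star U := by
  refine ⟨_, hA.1.eigenvectorUnitary.2, hA.1.eigenvalues, hA.eigenvalues_nonneg, ?_⟩
  have := hA.1.spectral_theorem
  rw [Unitary.conjStarAlgAut_apply] at this
  exact this

lemma trace_unitary_conj {U : Matrix n n ℂ} (hU : U ∈ unitaryGroup n ℂ) (M : Matrix n n ℂ) :
    (U * M * star U).trace = M.trace := by
  rw [trace_mul_cycle, (mem_unitaryGroup_iff').1 hU, one_mul]

lemma trace_conj_diagonal_mul {U V : Matrix n n ℂ} (hU : U ∈ unitaryGroup n ℂ) (a b : n → ℝ) :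
    ((U * diagonal (fun i => (a i : ℂ)) * star U) *
        (V * diagonal (fun i => (b i : ℂ)) * star V)).trace.re =
      ∑ i, ∑ j, a i * b j * Complex.normSq ((star V * U) j i) := by
  have h : (U * diagonal (fun i => (a i : ℂ)) * star U) *
        (V * diagonal (fun i => (b i : ℂ)) * star V) =
      U * (diagonal (fun i => (a i : ℂ)) * (star (star V * U) *
        (diagonal (fun i => (b i : ℂ)) * (star V * U)))) * star U := by
    rw [star_mul, star_star]
    simp only [mul_assoc]
    rw [(mem_unitaryGroup_iff).1 hU, mul_one]
  rw [h, trace_unitary_conj hU, trace, Complex.re_sum]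
  refine Finset.sum_congr rfl fun i _ => ?_
  rw [diag_apply, diagonal_mul, mul_apply, Finset.mul_sum, Complex.re_sum]
  refine Finset.sum_congr rfl fun j _ => ?_
  rw [diagonal_mul, star_apply, Complex.star_def, mul_left_comm _ (b j : ℂ),
    ← Complex.normSq_eq_conj_mul_self, Complex.re_ofReal_mul, Complex.re_ofReal_mul,
    Complex.ofReal_re, mul_assoc]

lemma suppProj_mul_of_suppLE {A : Matrix n n ℂ} (hA : A.PosSemidef) {X : Matrix n n ℂ}
    (h : suppLE X A) : X * suppProj A = X := by
  obtain ⟨U, hU, d, -, rfl⟩ := exists_conj_diagonal hA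
  have hU1 : star U * U = 1 := (mem_unitaryGroup_iff').1 hU
  have hU2 : U * star U = 1 := (mem_unitaryGroup_iff).1 hU
  have hXU : X * U * diagonal (fun i => (((if d i = 0 then 0 else 1 : ℝ)) : ℂ)) = X * U := by
    ext i j
    rw [mul_diagonal]
    by_cases hj : d j = 0
    · have h0 : (U * diagonal (fun i => (d i : ℂ)) * star U) *ᵥ (U *ᵥ Pi.single j 1) = 0 := by
        rw [mulVec_mulVec, mul_assoc, hU1, mul_one, ← mulVec_mulVec]
        have : diagonal (fun i => (d i : ℂ)) *ᵥ Pi.single j 1 = 0 := by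
          ext k
          rcases eq_or_ne k j with rfl | hk <;> simp [mulVec_diagonal, *]
        rw [this, mulVec_zero]
      have h1 := h _ h0
      rw [mulVec_mulVec] at h1
      have h2 := congrFun h1 i
      simp only [mulVec_single_one, col_apply, Pi.zero_apply] at h2
      rw [h2, zero_mul]
    · simp [hj]
  rw [suppProj, hermFun_conj_diagonal _ hU, ← mul_assoc, ← mul_assoc, hXU, mul_assoc, hU2, mul_one]

end SpectralCalculus

section Resolvent

variable {n : Type} [Fintype n]

/-- The concave quadratic functional whose supremum over `X` is the resolvent expectation
appearing in the integral representation of the relative entropy. -/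
def resolventObjective (ρ σ X : Matrix n n ℂ) (t : ℝ) : ℝ :=
  2 * (ρ * X).trace.re - (star X * σ * X).trace.re - t * (X * ρ * star X).trace.re

variable [DecidableEq n]

lemma resolventObjective_conj {U V : Matrix n n ℂ} (hU : U ∈ unitaryGroup n ℂ)
    (hV : V ∈ unitaryGroup n ℂ) (p q : n → ℝ) (Y : Matrix n n ℂ) (t : ℝ) :
    resolventObjective (U * diagonal (fun i => (p i : ℂ)) * star U)
        (V * diagonal (fun i => (q i : ℂ)) * star V) (V * Y * star U) t =
      ∑ i, ∑ j, (2 * (p i * (star ((star V * U) j i) * Y j i).re) -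
        (q j + t * p i) * Complex.normSq (Y j i)) := by
  have hU1 : star U * U = 1 := (mem_unitaryGroup_iff').1 hU
  have hV1 : star V * V = 1 := (mem_unitaryGroup_iff').1 hV
  have h1 : (U * diagonal (fun i => (p i : ℂ)) * star U) * (V * Y * star U) =
      U * (diagonal (fun i => (p i : ℂ)) * (star (star V * U) * Y)) * star U := by
    rw [star_mul, star_star]
    simp only [mul_assoc]
  have h2 : star (V * Y * star U) * (V * diagonal (fun i => (q i : ℂ)) * star V) *
      (V * Y * star U) = U * (star Y * (diagonal (fun i => (q i : ℂ)) * Y)) * star U := by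
    calc _ = U * (star Y * ((star V * V) * (diagonal (fun i => (q i : ℂ)) *
          ((star V * V) * Y)))) * star U := by
          simp only [star_mul, star_star, mul_assoc]
      _ = _ := by rw [hV1, one_mul, one_mul]
  have h3 : (V * Y * star U) * (U * diagonal (fun i => (p i : ℂ)) * star U) *
      star (V * Y * star U) = V * (Y * (diagonal (fun i => (p i : ℂ)) * star Y)) * star V := by
    calc _ = V * (Y * ((star U * U) * (diagonal (fun i => (p i : ℂ)) *
          ((star U * U) * star Y)))) * star V := by
          simp only [star_mul, star_star, mul_assoc]
      _ = _ := by rw [hU1, one_mul, one_mul]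
  have e1 : (diagonal (fun i => (p i : ℂ)) * (star (star V * U) * Y)).trace.re =
      ∑ i, ∑ j, p i * (star ((star V * U) j i) * Y j i).re := by
    rw [trace, Complex.re_sum]
    refine Finset.sum_congr rfl fun i _ => ?_
    rw [diag_apply, diagonal_mul, mul_apply, Finset.mul_sum, Complex.re_sum]
    refine Finset.sum_congr rfl fun j _ => ?_
    rw [Complex.re_ofReal_mul, star_apply]
  have e2 : (star Y * (diagonal (fun i => (q i : ℂ)) * Y)).trace.re =
      ∑ i, ∑ j, q j * Complex.normSq (Y j i) := by
    rw [trace, Complex.re_sum]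
    refine Finset.sum_congr rfl fun i _ => ?_
    rw [diag_apply, mul_apply, Complex.re_sum]
    refine Finset.sum_congr rfl fun j _ => ?_
    rw [diagonal_mul, star_apply, Complex.star_def, mul_left_comm,
      ← Complex.normSq_eq_conj_mul_self, Complex.re_ofReal_mul, Complex.ofReal_re]
  have e3 : (Y * (diagonal (fun i => (p i : ℂ)) * star Y)).trace.re =
      ∑ i, ∑ j, p i * Complex.normSq (Y j i) := by
    rw [Finset.sum_comm, trace, Complex.re_sum]
    refine Finset.sum_congr rfl fun i _ => ?_
    rw [diag_apply, mul_apply, Complex.re_sum]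
    refine Finset.sum_congr rfl fun j _ => ?_
    rw [diagonal_mul, star_apply, Complex.star_def, mul_left_comm, Complex.mul_conj,
      Complex.re_ofReal_mul, Complex.ofReal_re]
  rw [resolventObjective, h1, h2, h3, trace_unitary_conj hU, trace_unitary_conj hU,
    trace_unitary_conj hV, e1, e2, e3]
  simp only [Finset.mul_sum, ← Finset.sum_sub_distrib]
  refine Finset.sum_congr rfl fun i _ => Finset.sum_congr rfl fun j _ => ?_
  ring

lemma two_mul_re_sub_le {p s : ℝ} (hs : 0 ≤ s) (hp : s = 0 → p = 0) (w y : ℂ) :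
    2 * (p * (star w * y).re) - s * Complex.normSq y ≤ Complex.normSq w * p ^ 2 / s := by
  rcases hs.eq_or_lt with h | h
  · simp [← h, hp h.symm]
  · rw [le_div_iff₀ h]
    simp only [Complex.normSq_apply, Complex.star_def, Complex.mul_re, Complex.conj_re,
      Complex.conj_im]
    nlinarith [sq_nonneg (p * w.re - s * y.re), sq_nonneg (p * w.im - s * y.im)]

lemma two_mul_re_sub_eq {p s : ℝ} (w : ℂ) :
    2 * (p * (star w * (((p / s : ℝ) : ℂ) * w)).re) -
      s * Complex.normSq (((p / s : ℝ) : ℂ) * w) = Complex.normSq w * p ^ 2 / s := by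
  rw [mul_left_comm (star w), Complex.star_def, ← Complex.normSq_eq_conj_mul_self,
    Complex.re_ofReal_mul, Complex.ofReal_re, Complex.normSq_mul, Complex.normSq_ofReal]
  rcases eq_or_ne s 0 with rfl | h
  · simp
  · field_simp
    ring

/-- The relative entropy as a renormalized limit of a primitive of the resolvent expectation,
together with the variational characterization of the latter. -/
lemma exists_resolvent_representation {ρ σ : Matrix n n ℂ} (hρ : ρ.PosSemidef)
    (hσ : σ.PosSemidef) (hs : suppLE ρ σ) :
    ∃ F Q : ℝ → ℝ, F 0 = 0 ∧ (∀ t, 0 ≤ t → HasDerivAt F (Q t) t) ∧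
      (∀ t, 0 < t → ∀ X, resolventObjective ρ σ X t ≤ Q t) ∧
      (∀ t, 0 < t → ∃ X, Q t = resolventObjective ρ σ X t) ∧
      Filter.Tendsto (fun T => F T - Real.log T * ρ.trace.re) Filter.atTop
        (nhds (Real.log 2 * (ρ * (matLog2 ρ - matLog2 σ)).trace.re)) := by
  obtain ⟨U, hU, p, hp, hρU⟩ := exists_conj_diagonal hρ
  obtain ⟨V, hV, q, hq, hσV⟩ := exists_conj_diagonal hσ
  have hU1 : star U * U = 1 := (mem_unitaryGroup_iff').1 hU
  have hV1 : star V * V = 1 := (mem_unitaryGroup_iff').1 hV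
  have hV2 : V * star V = 1 := (mem_unitaryGroup_iff).1 hV
  set w : n → n → ℝ := fun i j => Complex.normSq ((star V * U) j i) with hw
  have hsupp : ∀ i j, w i j * p i ≠ 0 → 0 < q j ∧ 0 < p i := by
    intro i j hij
    have hpi : p i ≠ 0 := right_ne_zero_of_mul hij
    refine ⟨(hq j).lt_of_ne' fun hj => hij ?_, (hp i).lt_of_ne' hpi⟩
    have h0 : σ *ᵥ (V *ᵥ Pi.single j 1) = 0 := by
      rw [hσV, mulVec_mulVec, mul_assoc, hV1, mul_one, ← mulVec_mulVec]
      have : diagonal (fun i => (q i : ℂ)) *ᵥ Pi.single j 1 = 0 := by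
        ext k
        rcases eq_or_ne k j with rfl | hk <;> simp [mulVec_diagonal, *]
      rw [this, mulVec_zero]
    have h1 : star U *ᵥ (ρ *ᵥ (V *ᵥ Pi.single j 1)) = 0 := by rw [hs _ h0, mulVec_zero]
    rw [hρU, mulVec_mulVec, mulVec_mulVec] at h1
    have h2 : star U * (U * diagonal (fun i => (p i : ℂ)) * star U * V) =
        diagonal (fun i => (p i : ℂ)) * star (star V * U) := by
      calc _ = (star U * U) * (diagonal (fun i => (p i : ℂ)) * (star U * V)) := by
            simp only [mul_assoc]
        _ = _ := by rw [hU1, one_mul, star_mul, star_star]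
    have h3 := congrFun h1 i
    rw [← mul_assoc] at h2
    simp only [← mul_assoc] at h2 h3
    rw [h2] at h3
    simp only [mulVec_single_one, col_apply, Pi.zero_apply, diagonal_mul, star_apply,
      mul_eq_zero, Complex.ofReal_eq_zero, hpi, star_eq_zero, false_or] at h3
    simp [hw, h3]
  refine ⟨fun T => ∑ i, ∑ j, w i j * p i * (Real.log (q j + T * p i) - Real.log (q j)),
    fun T => ∑ i, ∑ j, w i j * p i ^ 2 / (q j + T * p i), ?_, ?_, ?_, ?_, ?_⟩
  · simp
  · intro t ht
    refine HasDerivAt.fun_sum fun i _ => HasDerivAt.fun_sum fun j _ => ?_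
    by_cases h0 : w i j * p i = 0
    · have : w i j * p i ^ 2 / (q j + t * p i) = 0 := by rw [pow_two, ← mul_assoc, h0]; simp
      rw [this]
      simpa [h0] using hasDerivAt_const t (0 : ℝ)
    · obtain ⟨hqj, hpi⟩ := hsupp i j h0
      have hpos : q j + t * p i ≠ 0 := by positivity
      have h1 : HasDerivAt (fun T => q j + T * p i) (p i) t := by
        simpa using ((hasDerivAt_id t).mul_const (p i)).const_add (q j)
      have h2 : w i j * p i ^ 2 / (q j + t * p i) = w i j * p i * (p i / (q j + t * p i)) := by
        ring
      rw [h2]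
      exact ((h1.log hpos).sub_const (Real.log (q j))).const_mul (w i j * p i)
  · intro t ht X
    have hX : X = V * (star V * X * U) * star U := by
      calc X = (V * star V) * X * (U * star U) := by
            rw [hV2, (mem_unitaryGroup_iff).1 hU, one_mul, mul_one]
        _ = _ := by simp only [mul_assoc]
    rw [hX, hρU, hσV, resolventObjective_conj hU hV]
    refine Finset.sum_le_sum fun i _ => Finset.sum_le_sum fun j _ => ?_
    refine two_mul_re_sub_le (by have := hp i; have := hq j; positivity) (fun h => ?_) _ _
    have h1 := mul_nonneg ht.le (hp i)
    have h2 : t * p i = 0 := by linarith [hq j]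
    exact (mul_eq_zero.1 h2).resolve_left ht.ne'
  · intro t ht
    refine ⟨V * (of fun j i => ((p i / (q j + t * p i) : ℝ) : ℂ) * (star V * U) j i) * star U, ?_⟩
    rw [hρU, hσV, resolventObjective_conj hU hV]
    refine Finset.sum_congr rfl fun i _ => Finset.sum_congr rfl fun j _ => ?_
    rw [of_apply, two_mul_re_sub_eq]
  · have hone : (1 : Matrix n n ℂ) = V * diagonal (fun _ => ((1 : ℝ) : ℂ)) * star V := by
      simp [hV2]
    have htr : ρ.trace.re = ∑ i, ∑ j, w i j * p i := by
      rw [← mul_one ρ, hone, hρU, trace_conj_diagonal_mul hU]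
      refine Finset.sum_congr rfl fun i _ => Finset.sum_congr rfl fun j _ => ?_
      simp only [hw]; ring
    have hlog : ∀ x : ℝ, (if x = 0 then 0 else Real.logb 2 x) = Real.log x / Real.log 2 := by
      intro x
      split_ifs with h
      · simp [h]
      · rfl
    have hent : Real.log 2 * (ρ * (matLog2 ρ - matLog2 σ)).trace.re =
        ∑ i, ∑ j, w i j * p i * (Real.log (p i) - Real.log (q j)) := by
      have h1 : (ρ * matLog2 ρ).trace.re =
          ∑ i, ∑ j, w i j * p i * Real.log (p i) / Real.log 2 := by
        have : ρ * matLog2 ρ =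
            U * diagonal (fun i => ((p i * (Real.log (p i) / Real.log 2) : ℝ) : ℂ)) * star U := by
          rw [hρU, matLog2, hermFun_conj_diagonal _ hU]
          simp only [hlog]
          calc _ = U * (diagonal (fun i => (p i : ℂ)) * ((star U * U) *
                diagonal (fun i => ((Real.log (p i) / Real.log 2 : ℝ) : ℂ)))) * star U := by
                simp only [mul_assoc]
            _ = _ := by
                rw [hU1, one_mul, diagonal_mul_diagonal]
                simp only [Complex.ofReal_mul]
        rw [← mul_one (ρ * matLog2 ρ), hone, this, trace_conj_diagonal_mul hU]
        refine Finset.sum_congr rfl fun i _ => Finset.sum_congr rfl fun j _ => ?_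
        simp only [hw]; ring
      have h2 : (ρ * matLog2 σ).trace.re =
          ∑ i, ∑ j, w i j * p i * Real.log (q j) / Real.log 2 := by
        rw [hρU, hσV, matLog2, hermFun_conj_diagonal _ hV, trace_conj_diagonal_mul hU]
        refine Finset.sum_congr rfl fun i _ => Finset.sum_congr rfl fun j _ => ?_
        rw [hlog]
        simp only [hw]; ring
      rw [mul_sub, trace_sub, Complex.sub_re, h1, h2]
      simp only [Finset.mul_sum, ← Finset.sum_sub_distrib]
      refine Finset.sum_congr rfl fun i _ => Finset.sum_congr rfl fun j _ => ?_
      have : Real.log 2 ≠ 0 := (Real.log_pos one_lt_two).ne'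
      field_simp
    rw [hent, htr]
    simp only [Finset.mul_sum, ← Finset.sum_sub_distrib]
    refine tendsto_finsetSum _ fun i _ => tendsto_finsetSum _ fun j _ => ?_
    by_cases h0 : w i j * p i = 0
    · simp [h0]
    obtain ⟨hqj, hpi⟩ := hsupp i j h0
    have hlim : Filter.Tendsto (fun T : ℝ => Real.log (q j / T + p i)) Filter.atTop
        (nhds (Real.log (p i))) := by
      have : Filter.Tendsto (fun T : ℝ => q j / T + p i) Filter.atTop (nhds (0 + p i)) :=
        (Filter.Tendsto.const_div_atTop Filter.tendsto_id (q j)).add_const _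
      rw [zero_add] at this
      exact (Real.continuousAt_log hpi.ne').tendsto.comp this
    refine ((hlim.sub_const (Real.log (q j))).const_mul (w i j * p i)).congr' ?_
    filter_upwards [Filter.eventually_gt_atTop 0] with T hT
    have : q j / T + p i = (q j + T * p i) / T := by field_simp
    rw [this, Real.log_div (by positivity) hT.ne']
    ring

end Resolvent

section PartialTrace

variable {m n : Type} [Fintype n]

/-- Partial trace over the right tensor factor. -/
def ptraceRight (M : Matrix (m × n) (m × n) ℂ) : Matrix m m ℂ :=
  fun r s => ∑ a, M (r, a) (s, a)

lemma Matrix.PosSemidef.ptraceRight {M : Matrix (m × n) (m × n) ℂ} (hM : M.PosSemidef) :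
    (ptraceRight M).PosSemidef := by
  have : _root_.ptraceRight M = ∑ a, M.submatrix (fun r => (r, a)) (fun r => (r, a)) := by
    ext r s
    simp [_root_.ptraceRight, Matrix.sum_apply]
  rw [this]
  exact posSemidef_sum _ fun a _ => hM.submatrix _

variable [Fintype m]

lemma trace_ptraceRight (M : Matrix (m × n) (m × n) ℂ) : (ptraceRight M).trace = M.trace := by
  simp [trace, ptraceRight, Fintype.sum_prod_type]

lemma trace_mul_kronecker_one [DecidableEq n] (M : Matrix (m × n) (m × n) ℂ) (X : Matrix m m ℂ) :
    (M * (X ⊗ₖ (1 : Matrix n n ℂ))).trace = (ptraceRight M * X).trace := by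
  simp only [trace, diag_apply, mul_apply, Fintype.sum_prod_type, kroneckerMap_apply, one_apply,
    mul_ite, mul_one, mul_zero, Finset.sum_ite_eq', Finset.mem_univ, if_true, ptraceRight,
    Finset.sum_mul]
  exact Finset.sum_congr rfl fun r _ => Finset.sum_comm

lemma trace_mul_one_kronecker [DecidableEq m] (M : Matrix (m × n) (m × n) ℂ) (X : Matrix n n ℂ) :
    (M * ((1 : Matrix m m ℂ) ⊗ₖ X)).trace = (ptraceLeft M * X).trace := by
  simp only [trace, diag_apply, mul_apply, Fintype.sum_prod_type, kroneckerMap_apply, one_apply,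
    ite_mul, mul_ite, one_mul, zero_mul, mul_zero, ptraceLeft, Finset.sum_mul]
  rw [Finset.sum_comm]
  refine Finset.sum_congr rfl fun a _ => ?_
  rw [Finset.sum_comm (s := Finset.univ (α := n))]
  simp

lemma resolventObjective_kronecker_one [DecidableEq n] (ρ σ : Matrix (m × n) (m × n) ℂ)
    (X : Matrix m m ℂ) (t : ℝ) :
    resolventObjective ρ σ (X ⊗ₖ (1 : Matrix n n ℂ)) t =
      resolventObjective (ptraceRight ρ) (ptraceRight σ) X t := by
  have hstar : star (X ⊗ₖ (1 : Matrix n n ℂ)) = star X ⊗ₖ (1 : Matrix n n ℂ) := by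
    rw [star_eq_conjTranspose, conjTranspose_kronecker, conjTranspose_one, star_eq_conjTranspose]
  have h1 : (star X ⊗ₖ (1 : Matrix n n ℂ) * σ * X ⊗ₖ (1 : Matrix n n ℂ)).trace =
      (star X * ptraceRight σ * X).trace := by
    rw [trace_mul_cycle, mul_assoc, trace_mul_comm, mul_assoc, trace_mul_comm, mul_assoc,
      ← mul_kronecker_mul, one_mul, trace_mul_kronecker_one, mul_assoc, trace_mul_comm (star X),
      mul_assoc]
  have h2 : (X ⊗ₖ (1 : Matrix n n ℂ) * ρ * star X ⊗ₖ (1 : Matrix n n ℂ)).trace =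
      (X * ptraceRight ρ * star X).trace := by
    rw [mul_assoc, trace_mul_comm, mul_assoc, ← mul_kronecker_mul, one_mul,
      trace_mul_kronecker_one, mul_assoc X, trace_mul_comm X, mul_assoc]
  rw [resolventObjective, resolventObjective, hstar, h1, h2, trace_mul_kronecker_one]

lemma suppLE_ptraceRight {ρ σ : Matrix (m × n) (m × n) ℂ} (hσ : σ.PosSemidef)
    (h : suppLE ρ σ) : suppLE (ptraceRight ρ) (ptraceRight σ) := by
  classical
  intro v hv
  let e : n → m × n → ℂ := fun a x => if x.2 = a then v x.1 else 0
  have key : ∀ (M : Matrix (m × n) (m × n) ℂ) (a : n) (x : m × n),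
      (M *ᵥ e a) x = ∑ s, M x (s, a) * v s := by
    intro M a x
    simp [mulVec, dotProduct, e, Fintype.sum_prod_type]
  have hsum : ∑ a, star (e a) ⬝ᵥ (σ *ᵥ e a) = 0 := by
    have h0 : star v ⬝ᵥ (ptraceRight σ *ᵥ v) = 0 := by rw [hv, dotProduct_zero]
    rw [← h0]
    simp only [dotProduct, key, Fintype.sum_prod_type, Pi.star_apply]
    rw [Finset.sum_comm]
    refine Finset.sum_congr rfl fun r _ => ?_
    simp only [e, apply_ite star, star_zero, ite_mul, zero_mul, mulVec, dotProduct, ptraceRight,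
      Finset.sum_mul, Finset.sum_ite_eq', Finset.mem_univ, if_true]
    rw [← Finset.mul_sum, Finset.sum_comm]
  have hzero : ∀ a, σ *ᵥ e a = 0 := by
    intro a
    rw [← hσ.dotProduct_mulVec_zero_iff]
    exact (Finset.sum_eq_zero_iff_of_nonneg fun b _ => hσ.dotProduct_mulVec_nonneg (e b)).1 hsum a
      (Finset.mem_univ a)
  ext r
  have hr : ∀ a, ∑ s, ρ (r, a) (s, a) * v s = 0 := by
    intro a
    rw [← key, h _ (hzero a), Pi.zero_apply]
  simp only [mulVec, dotProduct, ptraceRight, Finset.sum_mul, Pi.zero_apply]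
  rw [Finset.sum_comm]
  exact Finset.sum_eq_zero fun a _ => hr a

lemma suppLE_kronecker_left {A A' : Matrix m m ℂ} (h : suppLE A A') (B : Matrix n n ℂ) :
    suppLE (A ⊗ₖ B) (A' ⊗ₖ B) := by
  intro v hv
  have key : ∀ (C : Matrix m m ℂ) (r : m) (b : n),
      ((C ⊗ₖ B) *ᵥ v) (r, b) = (C *ᵥ fun s => ∑ c, B b c * v (s, c)) r := by
    intro C r b
    simp only [mulVec, dotProduct, Fintype.sum_prod_type, kroneckerMap_apply, Finset.mul_sum,
      mul_assoc]
  ext ⟨r, b⟩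
  rw [key, h _ ?_, Pi.zero_apply, Pi.zero_apply]
  ext s
  rw [← key, hv, Pi.zero_apply, Pi.zero_apply]

variable [DecidableEq m] [DecidableEq n]

/-- Monotonicity of the quantum relative entropy under partial trace. -/
theorem trace_mul_matLog2_sub_ptraceRight_le {ρ σ : Matrix (m × n) (m × n) ℂ}
    (hρ : ρ.PosSemidef) (hσ : σ.PosSemidef) (h : suppLE ρ σ) :
    (ptraceRight ρ * (matLog2 (ptraceRight ρ) - matLog2 (ptraceRight σ))).trace.re ≤
      (ρ * (matLog2 ρ - matLog2 σ)).trace.re := by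
  obtain ⟨F, Q, hF0, hF, hle, -, hlim⟩ := exists_resolvent_representation hρ hσ h
  obtain ⟨F', Q', hF0', hF', -, hex, hlim'⟩ :=
    exists_resolvent_representation hρ.ptraceRight hσ.ptraceRight (suppLE_ptraceRight hσ h)
  have hQ : ∀ t, 0 < t → Q' t ≤ Q t := by
    intro t ht
    obtain ⟨X, hX⟩ := hex t ht
    rw [hX, ← resolventObjective_kronecker_one]
    exact hle t ht _
  have hmono : MonotoneOn (fun t => F t - F' t) (Set.Ici 0) := by
    have hd : ∀ t, 0 ≤ t → HasDerivAt (fun t => F t - F' t) (Q t - Q' t) t := fun t ht =>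
      (hF t ht).fun_sub (hF' t ht)
    refine monotoneOn_of_deriv_nonneg (convex_Ici 0)
      (fun t ht => (hd t ht).continuousAt.continuousWithinAt) ?_ ?_
    · intro t ht
      rw [interior_Ici] at ht
      exact (hd t (le_of_lt ht)).differentiableAt.differentiableWithinAt
    · intro t ht
      rw [interior_Ici] at ht
      rw [(hd t (le_of_lt ht)).deriv]
      linarith [hQ t ht]
  have hlim2 := hlim.sub hlim'
  rw [trace_ptraceRight] at hlim2
  have hnn := ge_of_tendsto hlim2 (b := 0) (by
    filter_upwards [Filter.eventually_ge_atTop 0] with T hT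
    have := hmono Set.self_mem_Ici hT hT
    simp only [hF0, hF0'] at this
    linarith)
  rw [← mul_sub] at hnn
  linarith [nonneg_of_mul_nonneg_right hnn (Real.log_pos one_lt_two)]

lemma kronecker_conj_diagonal (U : Matrix m m ℂ) (V : Matrix n n ℂ) (a : m → ℝ) (b : n → ℝ) :
    (U * diagonal (fun i => (a i : ℂ)) * star U) ⊗ₖ (V * diagonal (fun i => (b i : ℂ)) * star V) =
      (U ⊗ₖ V) * diagonal (fun x => ((a x.1 * b x.2 : ℝ) : ℂ)) * star (U ⊗ₖ V) := by
  have hd : diagonal (fun x : m × n => ((a x.1 * b x.2 : ℝ) : ℂ)) =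
      diagonal (fun i => (a i : ℂ)) ⊗ₖ diagonal (fun i => (b i : ℂ)) := by
    ext ⟨i, j⟩ ⟨k, l⟩
    by_cases h1 : i = k <;> by_cases h2 : j = l <;> simp [h1, h2]
  rw [hd, star_eq_conjTranspose (U ⊗ₖ V), conjTranspose_kronecker, mul_kronecker_mul,
    mul_kronecker_mul, star_eq_conjTranspose, star_eq_conjTranspose]

lemma matLog2_kronecker {A : Matrix m m ℂ} {B : Matrix n n ℂ} (hA : A.PosSemidef)
    (hB : B.PosSemidef) :
    matLog2 (A ⊗ₖ B) = suppProj (A ⊗ₖ B) *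
      (matLog2 A ⊗ₖ (1 : Matrix n n ℂ) + (1 : Matrix m m ℂ) ⊗ₖ matLog2 B) := by
  obtain ⟨U, hU, a, -, rfl⟩ := exists_conj_diagonal hA
  obtain ⟨V, hV, b, -, rfl⟩ := exists_conj_diagonal hB
  have hW : U ⊗ₖ V ∈ unitaryGroup (m × n) ℂ := by
    rw [mem_unitaryGroup_iff, star_eq_conjTranspose, conjTranspose_kronecker, ← mul_kronecker_mul,
      ← star_eq_conjTranspose, ← star_eq_conjTranspose, (mem_unitaryGroup_iff).1 hU,
      (mem_unitaryGroup_iff).1 hV, one_kronecker_one]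
  have hU1 : (1 : Matrix m m ℂ) = U * diagonal (fun _ => ((1 : ℝ) : ℂ)) * star U := by
    simp [(mem_unitaryGroup_iff).1 hU]
  have hV1 : (1 : Matrix n n ℂ) = V * diagonal (fun _ => ((1 : ℝ) : ℂ)) * star V := by
    simp [(mem_unitaryGroup_iff).1 hV]
  rw [kronecker_conj_diagonal, matLog2, suppProj, matLog2, matLog2, hermFun_conj_diagonal _ hW,
    hermFun_conj_diagonal _ hW, hermFun_conj_diagonal _ hU, hermFun_conj_diagonal _ hV,
    hU1, hV1, kronecker_conj_diagonal, kronecker_conj_diagonal, ← add_mul, ← mul_add,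
    diagonal_add]
  set W := U ⊗ₖ V
  have hW1 : star W * W = 1 := (mem_unitaryGroup_iff').1 hW
  have hmul : ∀ D D' : Matrix (m × n) (m × n) ℂ,
      (W * D * star W) * (W * D' * star W) = W * (D * D') * star W := by
    intro D D'
    calc _ = W * (D * ((star W * W) * D')) * star W := by simp only [mul_assoc]
      _ = _ := by rw [hW1, one_mul]
  rw [hmul, diagonal_mul_diagonal]
  congr 3
  funext x
  norm_cast
  by_cases ha : a x.1 = 0
  · simp [ha]
  by_cases hb : b x.2 = 0
  · simp [hb]
  simp [ha, hb, Real.logb_mul]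

lemma trace_mul_matLog2_kronecker {A : Matrix m m ℂ} {B : Matrix n n ℂ} (hA : A.PosSemidef)
    (hB : B.PosSemidef) {ω : Matrix (m × n) (m × n) ℂ} (h : suppLE ω (A ⊗ₖ B)) :
    (ω * matLog2 (A ⊗ₖ B)).trace =
      (ptraceRight ω * matLog2 A).trace + (ptraceLeft ω * matLog2 B).trace := by
  rw [matLog2_kronecker hA hB, ← mul_assoc, suppProj_mul_of_suppLE (hA.kronecker hB) h, mul_add,
    trace_add, trace_mul_kronecker_one, trace_mul_one_kronecker]

lemma relEnt_self (ρ : Matrix n n ℂ) : relEnt ρ ρ = 0 := by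
  have h : suppLE ρ ρ := fun _ h => h
  rw [relEnt, if_pos h]
  simp

/-- Replacing the first marginal of the second argument costs the marginal relative entropy. -/
lemma relEnt_kronecker_le {ρ σ : Matrix (m × n) (m × n) ℂ} {k : Type} [Fintype k] [DecidableEq k]
    {ω : Matrix (m × k) (m × k) ℂ} {τ : Matrix k k ℂ} (hρ : ρ.PosSemidef) (hσ : σ.PosSemidef)
    (hτ : τ.PosSemidef) (hω : ptraceRight ω = ptraceRight ρ) :
    relEnt ω (ptraceRight σ ⊗ₖ τ) - relEnt ρ σ ≤ relEnt ω (ptraceRight ρ ⊗ₖ τ) := by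
  by_cases h1 : suppLE ρ σ
  swap
  · rw [relEnt.eq_def ρ, if_neg h1]
    simp
  by_cases h2 : suppLE ω (ptraceRight ρ ⊗ₖ τ)
  swap
  · rw [relEnt.eq_def ω (ptraceRight ρ ⊗ₖ τ), if_neg h2]
    exact le_top
  have h3 : suppLE ω (ptraceRight σ ⊗ₖ τ) := fun v hv =>
    h2 v (suppLE_kronecker_left (suppLE_ptraceRight hσ h1) τ v hv)
  rw [relEnt, relEnt, relEnt, if_pos h1, if_pos h2, if_pos h3, ← EReal.coe_sub, EReal.coe_le_coe_iff]
  have := trace_mul_matLog2_sub_ptraceRight_le hρ hσ h1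
  rw [mul_sub, trace_sub, Complex.sub_re] at this
  rw [mul_sub ω, mul_sub ω, trace_sub, trace_sub,
    trace_mul_matLog2_kronecker hσ.ptraceRight hτ h3,
    trace_mul_matLog2_kronecker hρ.ptraceRight hτ h2, hω]
  simp only [Complex.sub_re, Complex.add_re]
  linarith

end PartialTrace

lemma idTensor_replacer {R ι κ : Type} [Fintype ι] (τ : Matrix κ κ ℂ)
    (X : Matrix (R × ι) (R × ι) ℂ) :
    idTensor (fun Z : Matrix ι ι ℂ => Z.trace • τ) X = ptraceRight X ⊗ₖ τ := by
  ext p q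
  rfl

lemma ptraceRight_idTensor {R ι κ : Type} [Fintype ι] [Fintype κ]
    {N : Matrix ι ι ℂ → Matrix κ κ ℂ} (hN : ∀ X, (N X).trace = X.trace)
    (X : Matrix (R × ι) (R × ι) ℂ) : ptraceRight (idTensor N X) = ptraceRight X := by
  ext r s
  exact hN fun a b => X (r, a) (s, b)

/-- Energy-constrained amortization collapse for replacer channels:
`D^𝒜_{H,E}(N‖R) = D_{H,E}(N‖R)` for the quantum relative entropy. -/
theorem replacer_energy_constrained_collapse
    {ι κ : Type} [Fintype ι] [DecidableEq ι] [Fintype κ] [DecidableEq κ]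
    (N : Matrix ι ι ℂ → Matrix κ κ ℂ) (hN : IsChannel N)
    (τ : Matrix κ κ ℂ) (hτ : IsDensity τ)
    (H : Matrix ι ι ℂ) (hH : H.PosSemidef) (E : ℝ) (hE : 0 ≤ E)
    (hfeas : ∃ ρ : Matrix ι ι ℂ, IsDensity ρ ∧ ((H * ρ).trace).re ≤ E) :
    eAmortizedDiv relEntFam H E N (fun Z => Z.trace • τ) =
      eChannelDiv relEntFam H E N (fun Z => Z.trace • τ) := by
  apply le_antisymm
  · refine iSup_le fun R => iSup_le fun ρ => iSup_le fun σ => iSup_le fun hρ => iSup_le fun hσ =>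
      iSup_le fun hρE => iSup_le fun _ => ?_
    refine le_trans ?_ (le_iSup_of_le R <| le_iSup_of_le ρ <| le_iSup_of_le hρ <|
      le_iSup_of_le hρE le_rfl)
    rw [idTensor_replacer, idTensor_replacer]
    exact relEnt_kronecker_le hρ.1 hσ.1 hτ.1 (ptraceRight_idTensor hN.tracePres ρ)
  · refine iSup_le fun R => iSup_le fun ψ => iSup_le fun hψ => iSup_le fun hψE => ?_
    refine le_trans ?_ (le_iSup_of_le R <| le_iSup_of_le ψ <| le_iSup_of_le ψ <|
      le_iSup_of_le hψ <| le_iSup_of_le hψ <| le_iSup_of_le hψE <| le_iSup_of_le hψE le_rfl)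
    simp only [relEntFam, relEnt_self, sub_zero, le_refl]

end
end
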